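/- arXiv:1310.7834 — 2 statements merged into one kernel-verified Lean document; each statement's English description precedes it below -/
import Mathlib

section
/- Let (x,y) be a fractional solution to a matroid median instance with client set D and demands d'_j ≥ 0, with ∑_{i∈𝓕} x_{ij} = 1 for all j ∈ D, and suppose the clients are separated: c(j,k) ≥ 4·max(C̄_j, C̄_k) for all distinct j, k ∈ D, where C̄_j = ∑_i c(i,j) x_{ij}. Then there exists a half-integral fractional solution (x̂, ŷ) — a fractional solution all of whose entries x̂_{ij}, ŷ_i lie in {0, 1/2, 1}, with ∑_i x̂_{ij} = 1 for all j ∈ D — whose cost ∑_i f_i ŷ_i + ∑_{j∈D} ∑_i d'_j c(i,j) x̂_{ij} is at most 3 times the cost of (x, y). -/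
open scoped Classical
open Finset

/-- The rank function of a matroid: the maximum cardinality of an independent
subset of the given set. -/
noncomputable def matroidRank {α : Type*} (M : Matroid α) (S : Finset α) : ℕ :=
  (S.powerset.filter (fun I : Finset α => M.Indep ↑I)).sup Finset.card


lemma mm_rank_eq {F : Type*} [Fintype F] (M : Matroid F) (S : Finset F) :
    ((matroidRank M S : ℕ) : ℕ∞) = M.eRk (S : Set F) := by
  apply le_antisymm
  · rw [Matroid.le_eRk_iff]
    have hne : (S.powerset.filter (fun I : Finset F => M.Indep ↑I)).Nonempty :=
      ⟨∅, by simp⟩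
    obtain ⟨I, hI, hIc⟩ := Finset.exists_mem_eq_sup _ hne Finset.card
    simp only [Finset.mem_filter, Finset.mem_powerset] at hI
    refine ⟨I, by exact_mod_cast hI.1, hI.2, ?_⟩
    rw [Set.encard_coe_eq_coe_finsetCard]
    unfold matroidRank
    rw [hIc]
  · rw [Matroid.eRk_le_iff]
    intro I hIS hI
    have hfin : I.Finite := Set.toFinite I
    have h1 : I = (hfin.toFinset : Set F) := by simp
    rw [h1, Set.encard_coe_eq_coe_finsetCard]
    have : hfin.toFinset.card ≤ matroidRank M S := by
      unfold matroidRank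
      apply Finset.le_sup (f := Finset.card)
      simp only [Finset.mem_filter, Finset.mem_powerset]
      refine ⟨?_, by rw [← h1]; exact hI⟩
      intro i hi
      exact hIS (by simpa using hi)
    exact_mod_cast this

lemma mm_rank_submod {F : Type*} [Fintype F] (M : Matroid F) (S T : Finset F) :
    matroidRank M (S ∩ T) + matroidRank M (S ∪ T) ≤ matroidRank M S + matroidRank M T := by
  have h := M.eRk_inter_add_eRk_union_le (S : Set F) (T : Set F)
  rw [← Finset.coe_inter, ← Finset.coe_union, ← mm_rank_eq, ← mm_rank_eq, ← mm_rank_eq,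
    ← mm_rank_eq] at h
  exact_mod_cast h

lemma mm_rank_le_card {F : Type*} [Fintype F] (M : Matroid F) (S : Finset F) :
    matroidRank M S ≤ S.card := by
  apply Finset.sup_le
  intro I hI
  simp only [Finset.mem_filter, Finset.mem_powerset] at hI
  exact Finset.card_le_card hI.1

/-- Counting: every used label is used at least twice. -/
lemma mm_count {E L : Type*} [Fintype E] [Fintype L] (a : E → Option L)
    (ha : ∀ e, a e ≠ none → ∃ e', e' ≠ e ∧ a e' = a e) :
    2 * Fintype.card {l : L // ∃ e, a e = some l} ≤ (univ.filter (fun e => a e ≠ none)).card := by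
  have h := Finset.mul_card_image_le_card_of_maps_to
    (s := univ.filter (fun e => a e ≠ none)) (f := a)
    (t := (univ.filter (fun l : L => ∃ e, a e = some l)).map Function.Embedding.some)
    (by
      intro e he
      simp only [mem_filter, mem_univ, true_and] at he
      obtain ⟨l, hl⟩ := Option.ne_none_iff_exists'.1 he
      simp only [mem_map, mem_filter, mem_univ, true_and, Function.Embedding.some_apply]
      exact ⟨l, ⟨e, hl⟩, hl.symm⟩) 2
    (by
      intro o ho
      simp only [mem_map, mem_filter, mem_univ, true_and, Function.Embedding.some_apply] at ho
      obtain ⟨l, ⟨e, he⟩, rfl⟩ := ho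
      obtain ⟨e', hne, he'⟩ := ha e (by simp [he])
      have : ({e, e'} : Finset E) ⊆ (univ.filter (fun e => a e ≠ none)).filter (fun x => a x = some l) := by
        intro z hz
        simp only [mem_insert, mem_singleton] at hz
        rcases hz with rfl | rfl
        · simp [he]
        · simp [he', he]
      calc 2 = ({e, e'} : Finset E).card := by rw [Finset.card_pair hne.symm]
        _ ≤ _ := Finset.card_le_card this)
  rw [Finset.card_map] at h
  rw [Fintype.card_subtype]
  exact h

lemma mm_kernel {E L R : Type*} [Fintype E] [Fintype L] [Fintype R] [Nonempty E]
    (a : E → Option L) (b : E → Option R)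
    (ha : ∀ e, a e ≠ none → ∃ e', e' ≠ e ∧ a e' = a e)
    (hb : ∀ e, b e ≠ none → ∃ e', e' ≠ e ∧ b e' = b e) :
    ∃ d : E → ℝ, d ≠ 0 ∧ (∀ l, ∑ e, (if a e = some l then d e else 0) = 0) ∧
      (∀ l, ∑ e, (if b e = some l then d e else 0) = 0) := by
  let VL := {l : L // ∃ e, a e = some l}
  let VR := {l : R // ∃ e, b e = some l}
  let φ : (E → ℝ) →ₗ[ℝ] (VL ⊕ VR → ℝ) :=
    { toFun := fun d => Sum.elim (fun l => ∑ e, (if a e = some l.1 then d e else 0))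
        (fun l => ∑ e, (if b e = some l.1 then d e else 0))
      map_add' := by
        intro d d'
        ext (l | l) <;> simp only [Sum.elim_inl, Sum.elim_inr, Pi.add_apply] <;>
          rw [← Finset.sum_add_distrib] <;> apply Finset.sum_congr rfl <;> intro e _ <;>
          split_ifs <;> simp
      map_smul' := by
        intro t d
        ext (l | l) <;> simp [Finset.mul_sum] }
  by_cases hinj : Function.Injective φ
  · exfalso
    have h1 := LinearMap.finrank_le_finrank_of_injective hinj
    rw [Module.finrank_fintype_fun_eq_card, Module.finrank_fintype_fun_eq_card,
      Fintype.card_sum] at h1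
    have h2 := mm_count a ha
    have h3 := mm_count b hb
    have h4 : (univ.filter (fun e => a e ≠ none)).card ≤ Fintype.card E := Finset.card_le_univ _
    have h5 : (univ.filter (fun e => b e ≠ none)).card ≤ Fintype.card E := Finset.card_le_univ _
    have h6 : (univ.filter (fun e => a e ≠ none)).card = Fintype.card E := by
      change Fintype.card E ≤ Fintype.card {l : L // ∃ e, a e = some l} + Fintype.card {l : R // ∃ e, b e = some l} at h1
      omega
    have h7 : (univ.filter (fun e => b e ≠ none)).card = Fintype.card E := by
      change Fintype.card E ≤ Fintype.card {l : L // ∃ e, a e = some l} + Fintype.card {l : R // ∃ e, b e = some l} at h1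
      omega
    have h8 : Fintype.card E = Fintype.card VL + Fintype.card VR := by
      change Fintype.card E = Fintype.card {l : L // ∃ e, a e = some l} + Fintype.card {l : R // ∃ e, b e = some l}
      change Fintype.card E ≤ Fintype.card {l : L // ∃ e, a e = some l} + Fintype.card {l : R // ∃ e, b e = some l} at h1
      omega
    rw [Finset.card_eq_iff_eq_univ] at h6 h7
    have ha' : ∀ e, a e ≠ none := fun e => by
      have : e ∈ univ.filter (fun e => a e ≠ none) := by rw [h6]; simp
      simpa using this
    have hb' : ∀ e, b e ≠ none := fun e => by
      have : e ∈ univ.filter (fun e => b e ≠ none) := by rw [h7]; simp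
      simpa using this
    have hsurj : Function.Surjective φ := by
      rw [← LinearMap.injective_iff_surjective_of_finrank_eq_finrank]
      · exact hinj
      · rw [Module.finrank_fintype_fun_eq_card, Module.finrank_fintype_fun_eq_card,
          Fintype.card_sum, h8]
    let e0 : E := Classical.arbitrary E
    obtain ⟨l0, hl0⟩ := Option.ne_none_iff_exists'.1 (ha' e0)
    let v0 : VL := ⟨l0, e0, hl0⟩
    obtain ⟨d, hd⟩ := hsurj (Pi.single (Sum.inl v0) 1)
    have hL : ∑ l : VL, φ d (Sum.inl l) = ∑ e, d e := by
      change ∑ l : VL, ∑ e, (if a e = some l.1 then d e else 0) = _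
      rw [Finset.sum_comm]
      apply Finset.sum_congr rfl
      intro e _
      obtain ⟨l, hl⟩ := Option.ne_none_iff_exists'.1 (ha' e)
      rw [Finset.sum_eq_single (⟨l, e, hl⟩ : VL)]
      · simp [hl]
      · intro m _ hm
        rw [if_neg]
        intro h
        apply hm
        apply Subtype.ext
        rw [hl] at h
        simpa using h.symm
      · simp
    have hR : ∑ l : VR, φ d (Sum.inr l) = ∑ e, d e := by
      change ∑ l : VR, ∑ e, (if b e = some l.1 then d e else 0) = _
      rw [Finset.sum_comm]
      apply Finset.sum_congr rfl
      intro e _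
      obtain ⟨l, hl⟩ := Option.ne_none_iff_exists'.1 (hb' e)
      rw [Finset.sum_eq_single (⟨l, e, hl⟩ : VR)]
      · simp [hl]
      · intro m _ hm
        rw [if_neg]
        intro h
        apply hm
        apply Subtype.ext
        rw [hl] at h
        simpa using h.symm
      · simp
    rw [← hR, hd] at hL
    have hone : ∑ l : VL, (Pi.single (Sum.inl v0) 1 : VL ⊕ VR → ℝ) (Sum.inl l) = 1 := by
      rw [Finset.sum_eq_single v0]
      · simp
      · intro l _ hl
        simp [hl]
      · simp
    rw [hone] at hL
    simp at hL
  · rw [← LinearMap.ker_eq_bot] at hinj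
    obtain ⟨d, hd, hd0⟩ := Submodule.exists_mem_ne_zero_of_ne_bot hinj
    rw [LinearMap.mem_ker] at hd
    refine ⟨d, hd0, ?_, ?_⟩
    · intro l
      by_cases h : ∃ e, a e = some l
      · exact congrFun hd (Sum.inl ⟨l, h⟩)
      · push Not at h
        simp [h]
    · intro l
      by_cases h : ∃ e, b e = some l
      · exact congrFun hd (Sum.inr ⟨l, h⟩)
      · push Not at h
        simp [h]

/-- The polytope of the half-integral rounding step. -/
structure MMFeas {F D : Type*} (r : Finset F → ℕ) (A G : D → Finset F)
    (v : F → ℝ) : Prop where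
  nonneg : ∀ i, 0 ≤ v i
  rank : ∀ S : Finset F, ∑ i ∈ S, v i ≤ (r S : ℝ)
  lower : ∀ j, 1 / 2 ≤ ∑ i ∈ A j, v i
  upper : ∀ j, ∑ i ∈ G j, v i ≤ 1

/-- A set with half-integral sum does not contain exactly one element of fractional value. -/
lemma mm_two {F : Type*} (H : AddSubgroup ℝ) (v : F → ℝ) (B : Finset F)
    (hB : ∑ i ∈ B, v i ∈ H) (i : F) (hi : i ∈ B) (hv : v i ∉ H) :
    ∃ i' ∈ B, i' ≠ i ∧ v i' ∉ H := by
  by_contra hcon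
  push Not at hcon
  apply hv
  have h1 : ∑ k ∈ B.erase i, v k ∈ H := by
    apply AddSubgroup.sum_mem
    intro k hk
    rw [Finset.mem_erase] at hk
    exact hcon k hk.2 hk.1
  have h2 := Finset.add_sum_erase B v hi
  have h3 : v i = ∑ i ∈ B, v i - ∑ k ∈ B.erase i, v k := by linarith
  rw [h3]
  exact H.sub_mem hB h1

lemma mm_tight_lattice {F D : Type*} (r : Finset F → ℕ)
    (hsub : ∀ S T, r (S ∩ T) + r (S ∪ T) ≤ r S + r T)
    (A G : D → Finset F) (v : F → ℝ) (hv : MMFeas r A G v) (S T : Finset F)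
    (hS : ∑ i ∈ S, v i = r S) (hT : ∑ i ∈ T, v i = r T) :
    ∑ i ∈ S ∩ T, v i = r (S ∩ T) ∧ ∑ i ∈ S ∪ T, v i = r (S ∪ T) := by
  have h1 := hv.rank (S ∩ T)
  have h2 := hv.rank (S ∪ T)
  have h3 : ((r (S ∩ T) : ℝ) + r (S ∪ T)) ≤ r S + r T := by exact_mod_cast hsub S T
  have h4 := Finset.sum_union_inter (s₁ := S) (s₂ := T) (f := v)
  constructor <;> linarith

/-- The class of elements contained in the same tight sets as a covered element has an
integral sum. -/
lemma mm_class {F D : Type*} [Fintype F] (r : Finset F → ℕ)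
    (hsub : ∀ S T, r (S ∩ T) + r (S ∪ T) ≤ r S + r T) (hr0 : r ∅ = 0)
    (A G : D → Finset F) (v : F → ℝ) (hv : MMFeas r A G v) (i : F)
    (hi : ∃ S : Finset F, ∑ i ∈ S, v i = r S ∧ i ∈ S) :
    ∃ n : ℤ, ∑ k ∈ univ.filter (fun k => ∀ S : Finset F, ∑ i ∈ S, v i = r S → (i ∈ S ↔ k ∈ S)), v k
      = n := by
  obtain ⟨S0, hS0, hiS0⟩ := hi
  -- the least tight set containing `i`
  have hmin : ∃ I : Finset F, (∑ k ∈ I, v k = r I ∧ i ∈ I) ∧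
      ∀ S : Finset F, ∑ i ∈ S, v i = r S → i ∈ S → I ⊆ S := by
    obtain ⟨I, hI, hImin⟩ := Finset.exists_min_image
      (univ.filter (fun I : Finset F => ∑ k ∈ I, v k = r I ∧ i ∈ I)) Finset.card
      ⟨S0, by simp [hS0, hiS0]⟩
    simp only [mem_filter, mem_univ, true_and] at hI hImin
    refine ⟨I, hI, fun S hS hiS => ?_⟩
    have h1 := (mm_tight_lattice r hsub A G v hv I S hI.1 hS).1
    have h2 := hImin (I ∩ S) ⟨h1, by simp [hI.2, hiS]⟩
    have h3 := Finset.eq_of_subset_of_card_le (Finset.inter_subset_left (s₁ := I) (s₂ := S)) h2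
    rw [← h3]
    exact Finset.inter_subset_right
  obtain ⟨I, ⟨hI, hiI⟩, hImin⟩ := hmin
  -- the largest tight subset of `I` avoiding `i`
  have hmax : ∃ U : Finset F, (∑ k ∈ U, v k = r U ∧ i ∉ U ∧ U ⊆ I) ∧
      ∀ S : Finset F, ∑ i ∈ S, v i = r S → i ∉ S → S ⊆ I → S ⊆ U := by
    obtain ⟨U, hU, hUmax⟩ := Finset.exists_max_image
      (univ.filter (fun I' : Finset F => ∑ k ∈ I', v k = r I' ∧ i ∉ I' ∧ I' ⊆ I)) Finset.card
      ⟨∅, by simp [hr0]⟩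
    simp only [mem_filter, mem_univ, true_and] at hU hUmax
    refine ⟨U, hU, fun S hS hiS hSI => ?_⟩
    have h1 := (mm_tight_lattice r hsub A G v hv U S hU.1 hS).2
    have h2 := hUmax (U ∪ S) ⟨h1, by simp [hU.2.1, hiS], Finset.union_subset hU.2.2 hSI⟩
    have h3 := Finset.eq_of_subset_of_card_le (Finset.subset_union_left (s₁ := U) (s₂ := S)) h2
    rw [h3]
    exact Finset.subset_union_right
  obtain ⟨U, ⟨hU, hiU, hUI⟩, hUmax⟩ := hmax
  have hcls : univ.filter (fun k => ∀ S : Finset F, ∑ i ∈ S, v i = r S → (i ∈ S ↔ k ∈ S))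
      = I \ U := by
    ext k
    simp only [mem_filter, mem_univ, true_and, mem_sdiff]
    constructor
    · intro h
      exact ⟨(h I hI).1 hiI, fun hk => hiU ((h U hU).2 hk)⟩
    · rintro ⟨hkI, hkU⟩ S hS
      constructor
      · intro hiS
        exact hImin S hS hiS hkI
      · intro hkS
        by_contra hiS
        apply hkU
        apply hUmax (I ∩ S) (mm_tight_lattice r hsub A G v hv I S hI hS).1 _
          Finset.inter_subset_left
        · simp [hkI, hkS]
        · simp [hiS]
  rw [hcls]
  refine ⟨(r I : ℤ) - r U, ?_⟩
  have := Finset.sum_sdiff hUI (f := v)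
  push_cast
  linarith

lemma mm_direction {F D : Type*} [Fintype F] [Fintype D] (r : Finset F → ℕ)
    (hsub : ∀ S T, r (S ∩ T) + r (S ∪ T) ≤ r S + r T) (hr0 : r ∅ = 0)
    (near : F → D) (A G : D → Finset F) (hAG : ∀ j, A j ⊆ G j)
    (hG : ∀ j, ∀ i ∈ G j, near i = j)
    (v : F → ℝ) (hv : MMFeas r A G v)
    (hfrac : ∃ i, v i ∉ AddSubgroup.zmultiples (1 / 2 : ℝ)) :
    ∃ d : F → ℝ, d ≠ 0 ∧ (∀ i, v i = 0 → d i = 0) ∧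
      (∀ S : Finset F, ∑ i ∈ S, v i = r S → ∑ i ∈ S, d i = 0) ∧
      (∀ j, ∑ i ∈ A j, v i = 1 / 2 → ∑ i ∈ A j, d i = 0) ∧
      (∀ j, ∑ i ∈ G j, v i = 1 → ∑ i ∈ G j, d i = 0) := by
  let H := AddSubgroup.zmultiples (1 / 2 : ℝ)
  have hhalf : (1 / 2 : ℝ) ∈ H := AddSubgroup.mem_zmultiples _
  have hone : (1 : ℝ) ∈ H := by
    have := H.add_mem hhalf hhalf
    norm_num at this
    exact this
  have hintmem : ∀ n : ℤ, (n : ℝ) ∈ H := by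
    intro n
    have := H.zsmul_mem hone n
    simpa using this
  let cls : F → Finset F := fun i =>
    univ.filter (fun k => ∀ S : Finset F, ∑ i ∈ S, v i = r S → (i ∈ S ↔ k ∈ S))
  have hcls : ∀ i k, k ∈ cls i ↔ ∀ S : Finset F, ∑ i ∈ S, v i = r S → (i ∈ S ↔ k ∈ S) := by
    intro i k; simp [cls]
  have hself : ∀ i, i ∈ cls i := fun i => by rw [hcls]; intro S _; rfl
  have hclseq : ∀ i k, k ∈ cls i → cls k = cls i := by
    intro i k hk
    rw [hcls] at hk
    ext z
    rw [hcls, hcls]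
    constructor
    · intro h S hS; rw [hk S hS, h S hS]
    · intro h S hS; rw [← hk S hS, h S hS]
  let cov : F → Prop := fun i => ∃ S : Finset F, ∑ i ∈ S, v i = r S ∧ i ∈ S
  have hcovk : ∀ i k, k ∈ cls i → cov i → cov k := by
    rintro i k hk ⟨S, hS, hiS⟩
    exact ⟨S, hS, ((hcls i k).1 hk S hS).1 hiS⟩
  let tA : D → Prop := fun j => ∑ i ∈ A j, v i = 1 / 2
  let tG : D → Prop := fun j => ∑ i ∈ G j, v i = 1
  let a0 : F → Option (Finset F) := fun i => if cov i then some (cls i) else none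
  let b0 : F → Option (D × Bool) := fun i =>
    if i ∈ A (near i) ∧ tA (near i) then some (near i, true)
    else if i ∈ G (near i) ∧ tG (near i) then some (near i, false) else none
  let E := {i : F // v i ∉ H}
  have : Nonempty E := by
    obtain ⟨i, hi⟩ := hfrac
    exact ⟨⟨i, hi⟩⟩
  have hbA : ∀ i j, b0 i = some (j, true) ↔ (i ∈ A j ∧ tA j) := by
    intro i j
    constructor
    · intro h
      simp only [b0] at h
      split_ifs at h with h1 h2
      · simp only [Option.some.injEq, Prod.mk.injEq, and_true] at h
        rw [h] at h1; exact h1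
      · simp at h
    · rintro ⟨h1, h2⟩
      have h3 := hG j i (hAG j h1)
      simp only [b0, h3]
      rw [if_pos ⟨h1, h2⟩]
  have hbG : ∀ i j, b0 i = some (j, false) ↔ (i ∈ G j ∧ tG j ∧ ¬ (i ∈ A j ∧ tA j)) := by
    intro i j
    constructor
    · intro h
      simp only [b0] at h
      split_ifs at h with h1 h2
      · simp at h
      · simp only [Option.some.injEq, Prod.mk.injEq, and_true] at h
        rw [h] at h1 h2; exact ⟨h2.1, h2.2, h1⟩
    · rintro ⟨h1, h2, h4⟩
      have h3 := hG j i h1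
      simp only [b0, h3]
      rw [if_neg h4, if_pos ⟨h1, h2⟩]
  obtain ⟨d, hd0, hdL, hdR⟩ := mm_kernel (E := E) (fun e => a0 e.1) (fun e => b0 e.1)
    (by
      rintro ⟨i, hi⟩ hne
      have hcov : cov i := by
        by_contra h
        simp [a0, h] at hne
      obtain ⟨n, hn⟩ := mm_class r hsub hr0 A G v hv i hcov
      obtain ⟨k, hk, hki, hkH⟩ := mm_two H v (cls i) (by rw [hn]; exact hintmem n) i (hself i) hi
      refine ⟨⟨k, hkH⟩, fun h => hki (congrArg Subtype.val h), ?_⟩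
      simp only [a0]
      rw [if_pos hcov, if_pos (hcovk i k hk hcov), hclseq i k hk])
    (by
      rintro ⟨i, hi⟩ hne
      obtain ⟨⟨j, t⟩, hjt⟩ := Option.ne_none_iff_exists'.1 hne
      have hjt : b0 i = some (j, t) := hjt
      cases t with
      | true =>
        have h1 := (hbA i j).1 hjt
        obtain ⟨k, hk, hki, hkH⟩ := mm_two H v (A j) (by rw [h1.2]; exact hhalf) i h1.1 hi
        refine ⟨⟨k, hkH⟩, fun h => hki (congrArg Subtype.val h), ?_⟩
        change b0 k = b0 i
        rw [hjt, hbA]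
        exact ⟨hk, h1.2⟩
      | false =>
        have h1 := (hbG i j).1 hjt
        by_cases hA : tA j
        · obtain ⟨k, hk, hki, hkH⟩ := mm_two H v (G j \ A j) (by
            have h5 := Finset.sum_sdiff (hAG j) (f := v)
            have h6 : ∑ i ∈ G j \ A j, v i = 1 / 2 := by
              have h7 : ∑ i ∈ A j, v i = 1 / 2 := hA
              have h8 : ∑ i ∈ G j, v i = 1 := h1.2.1
              linarith
            rw [h6]; exact hhalf) i
            (by rw [mem_sdiff]; exact ⟨h1.1, fun h => h1.2.2 ⟨h, hA⟩⟩) hi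
          refine ⟨⟨k, hkH⟩, fun h => hki (congrArg Subtype.val h), ?_⟩
          change b0 k = b0 i
          rw [mem_sdiff] at hk
          rw [hjt, hbG]
          exact ⟨hk.1, h1.2.1, fun h => hk.2 h.1⟩
        · obtain ⟨k, hk, hki, hkH⟩ := mm_two H v (G j) (by rw [h1.2.1]; exact hone) i h1.1 hi
          refine ⟨⟨k, hkH⟩, fun h => hki (congrArg Subtype.val h), ?_⟩
          change b0 k = b0 i
          rw [hjt, hbG]
          exact ⟨hk, h1.2.1, fun h => hA h.2⟩)
  let d' : F → ℝ := fun i => if h : v i ∉ H then d ⟨i, h⟩ else 0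
  have hd'E : ∀ e : E, d' e.1 = d e := fun e => by simp only [d']; rw [dif_pos e.2]
  have htrans : ∀ (p : F → Prop) [DecidablePred p], ∑ i ∈ univ.filter p, d' i = ∑ e : E, if p e.1 then d e else 0 := by
    intro p _
    rw [Finset.sum_filter]
    have h1 : ∑ e : E, (if p e.1 then d e else 0) = ∑ e : E, (fun i => if p i then d' i else 0) e.1 := by
      apply Finset.sum_congr rfl
      intro e _
      simp only [hd'E]
    rw [h1]
    rw [← Finset.sum_subtype (univ.filter (fun i => v i ∉ H)) (by simp)
      (fun i => if p i then d' i else 0)]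
    symm
    apply Finset.sum_subset (Finset.subset_univ _)
    intro i _ hi
    simp only [mem_filter, mem_univ, true_and] at hi
    simp only [d']
    rw [dif_neg hi, ite_self]
  have hclsum : ∀ i, cov i → ∑ k ∈ cls i, d' k = 0 := by
    intro i hi
    have h1 : cls i = univ.filter (fun k => a0 k = some (cls i)) := by
      ext k
      simp only [mem_filter, mem_univ, true_and, a0]
      constructor
      · intro hk
        rw [if_pos (hcovk i k hk hi), hclseq i k hk]
      · intro h
        split_ifs at h with h2
        simp only [Option.some.injEq] at h
        rw [← h]; exact hself k
    rw [h1, htrans]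
    convert hdL (cls i)
  have hAsum : ∀ j, tA j → ∑ i ∈ A j, d' i = 0 := by
    intro j hj
    have h1 : A j = univ.filter (fun k => b0 k = some (j, true)) := by
      ext k
      simp only [mem_filter, mem_univ, true_and, hbA, hj, and_true]
    rw [h1, htrans]
    convert hdR (j, true)
  refine ⟨d', ?_, ?_, ?_, hAsum, ?_⟩
  · intro h
    apply hd0
    funext e
    rw [← hd'E, h]
    rfl
  · intro i hi
    simp only [d']
    rw [dif_neg]
    rw [hi]
    simp
  · intro S hS
    rw [← Finset.sum_fiberwise_of_maps_to (s := S) (t := S.image cls) (g := cls)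
      (fun i hi => Finset.mem_image_of_mem _ hi)]
    apply Finset.sum_eq_zero
    intro C hC
    obtain ⟨i, hi, rfl⟩ := Finset.mem_image.1 hC
    have h1 : S.filter (fun k => cls k = cls i) = cls i := by
      ext k
      simp only [mem_filter]
      constructor
      · rintro ⟨_, h⟩
        rw [← h]; exact hself k
      · intro hk
        exact ⟨((hcls i k).1 hk S hS).1 hi, hclseq i k hk⟩
    rw [h1]
    exact hclsum i ⟨S, hS, hi⟩
  · intro j hj
    have h2 : ∑ i ∈ univ.filter (fun k => b0 k = some (j, false)), d' i = 0 := by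
      rw [htrans]
      convert hdR (j, false)
    by_cases hA : tA j
    · have h1 : G j \ A j = univ.filter (fun k => b0 k = some (j, false)) := by
        ext k
        have hj' : tG j := hj
        simp only [mem_filter, mem_univ, true_and, hbG, hj', hA, and_true, mem_sdiff]
      rw [← Finset.sum_sdiff (hAG j), h1, h2, hAsum j hA, add_zero]
    · have h1 : G j = univ.filter (fun k => b0 k = some (j, false)) := by
        ext k
        have hj' : tG j := hj
        simp only [mem_filter, mem_univ, true_and, hbG, hj', hA, and_false, not_false_eq_true,
          and_true]
      rw [h1, h2]

/-- Small perturbation of one linear constraint. -/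
lemma mm_eps (p q b : ℝ) (h : p ≤ b) (hq : p = b → q = 0) :
    ∀ᶠ t in nhds (0 : ℝ), p + t * q ≤ b := by
  rcases h.lt_or_eq with h | h
  · have hc : Filter.Tendsto (fun t : ℝ => p + t * q) (nhds 0) (nhds (p + 0 * q)) := by
      apply Continuous.tendsto
      fun_prop
    have h2 : p + 0 * q < b := by linarith
    exact (hc.eventually (gt_mem_nhds h2)).mono fun t ht => le_of_lt ht
  · rw [hq h]
    simp [h]

lemma mm_perturb {F D : Type*} [Fintype F] [Fintype D] (r : Finset F → ℕ)
    (A G : D → Finset F) (v d : F → ℝ) (hv : MMFeas r A G v)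
    (h1 : ∀ i, v i = 0 → d i = 0)
    (h2 : ∀ S : Finset F, ∑ i ∈ S, v i = r S → ∑ i ∈ S, d i = 0)
    (h3 : ∀ j, ∑ i ∈ A j, v i = 1 / 2 → ∑ i ∈ A j, d i = 0)
    (h4 : ∀ j, ∑ i ∈ G j, v i = 1 → ∑ i ∈ G j, d i = 0) :
    ∀ᶠ t in nhds (0 : ℝ), MMFeas r A G (fun i => v i + t * d i) := by
  have e1 : ∀ᶠ t in nhds (0 : ℝ), ∀ i, - v i + t * (- d i) ≤ 0 :=
    Filter.eventually_all.2 fun i => mm_eps _ _ _ (by linarith [hv.nonneg i])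
      (fun h => by rw [h1 i (by linarith)]; simp)
  have e2 : ∀ᶠ t in nhds (0 : ℝ), ∀ S : Finset F, ∑ i ∈ S, v i + t * ∑ i ∈ S, d i ≤ r S :=
    Filter.eventually_all.2 fun S => mm_eps _ _ _ (hv.rank S) (h2 S)
  have e3 : ∀ᶠ t in nhds (0 : ℝ), ∀ j, - ∑ i ∈ A j, v i + t * (- ∑ i ∈ A j, d i) ≤ - (1 / 2) :=
    Filter.eventually_all.2 fun j => mm_eps _ _ _ (by linarith [hv.lower j])
      (fun h => by rw [h3 j (by linarith)]; simp)
  have e4 : ∀ᶠ t in nhds (0 : ℝ), ∀ j, ∑ i ∈ G j, v i + t * ∑ i ∈ G j, d i ≤ 1 :=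
    Filter.eventually_all.2 fun j => mm_eps _ _ _ (hv.upper j) (h4 j)
  filter_upwards [e1, e2, e3, e4] with t g1 g2 g3 g4
  refine ⟨fun i => ?_, fun S => ?_, fun j => ?_, fun j => ?_⟩
  · linarith [g1 i]
  · rw [Finset.sum_add_distrib, ← Finset.mul_sum]; exact g2 S
  · rw [Finset.sum_add_distrib, ← Finset.mul_sum]; linarith [g3 j]
  · rw [Finset.sum_add_distrib, ← Finset.mul_sum]; exact g4 j

lemma mm_halfint {F D : Type*} [Fintype F] [Fintype D] (r : Finset F → ℕ)
    (hsub : ∀ S T, r (S ∩ T) + r (S ∪ T) ≤ r S + r T) (hcard : ∀ S, r S ≤ S.card)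
    (near : F → D) (A G : D → Finset F) (hAG : ∀ j, A j ⊆ G j)
    (hG : ∀ j, ∀ i ∈ G j, near i = j) (w y : F → ℝ) (hy : MMFeas r A G y) :
    ∃ v : F → ℝ, MMFeas r A G v ∧ (∀ i, v i ∈ AddSubgroup.zmultiples (1 / 2 : ℝ)) ∧
      ∑ i, w i * v i ≤ ∑ i, w i * y i := by
  have hr0 : r ∅ = 0 := by simpa using hcard ∅
  let P : Set (F → ℝ) := {v | MMFeas r A G v}
  have hPclosed : IsClosed P := by
    have hP : P = {v | ∀ i, 0 ≤ v i} ∩ {v | ∀ S : Finset F, ∑ i ∈ S, v i ≤ (r S : ℝ)} ∩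
        {v | ∀ j, 1 / 2 ≤ ∑ i ∈ A j, v i} ∩ {v | ∀ j, ∑ i ∈ G j, v i ≤ 1} := by
      ext v
      constructor
      · intro h
        have h : MMFeas r A G v := h
        exact ⟨⟨⟨h.nonneg, h.rank⟩, h.lower⟩, h.upper⟩
      · rintro ⟨⟨⟨g1, g2⟩, g3⟩, g4⟩
        exact ⟨g1, g2, g3, g4⟩
    rw [hP]
    simp only [Set.ofPred_forall]
    refine ((IsClosed.inter ?_ ?_).inter ?_).inter ?_ <;> apply isClosed_iInter <;> intro k <;>
      apply isClosed_le <;> fun_prop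
  have hPsub : P ⊆ Set.Icc (fun _ => 0) (fun _ => 1) := by
    intro v hv
    have hv' : MMFeas r A G v := hv
    refine ⟨hv'.nonneg, fun i => ?_⟩
    have h1 := hv'.rank {i}
    have h2 : (r {i} : ℝ) ≤ 1 := by exact_mod_cast (by simpa using hcard {i})
    simp only [Finset.sum_singleton] at h1
    exact h1.trans h2
  have hPcomp : IsCompact P := isCompact_Icc.of_isClosed_subset hPclosed hPsub
  have hcont : Continuous (fun v : F → ℝ => ∑ i, w i * v i) := by fun_prop
  obtain ⟨m, hmP, hm⟩ := hPcomp.exists_isMinOn ⟨y, hy⟩ hcont.continuousOn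
  rw [isMinOn_iff] at hm
  let Q : Set (F → ℝ) := P ∩ {v | ∑ i, w i * v i ≤ ∑ i, w i * m i}
  have hQcomp : IsCompact Q :=
    hPcomp.inter_right (isClosed_le hcont continuous_const)
  obtain ⟨v, hv⟩ := hQcomp.extremePoints_nonempty ⟨m, hmP, le_refl (∑ i, w i * m i)⟩
  rw [mem_extremePoints_iff_left] at hv
  obtain ⟨⟨hvP, hvm⟩, hext⟩ := hv
  have hvm : ∑ i, w i * v i ≤ ∑ i, w i * m i := hvm
  refine ⟨v, hvP, ?_, hvm.trans (hm y hy)⟩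
  by_contra hfrac
  push Not at hfrac
  obtain ⟨d, hd0, h1, h2, h3, h4⟩ := mm_direction r hsub hr0 near A G hAG hG v hvP hfrac
  have hev := mm_perturb r A G v d hvP h1 h2 h3 h4
  have hev' : ∀ᶠ t in nhds (0 : ℝ), MMFeas r A G (fun i => v i + (-t) * d i) := by
    have : Filter.Tendsto (fun t : ℝ => -t) (nhds 0) (nhds 0) := by
      simpa using (continuous_neg (G := ℝ)).tendsto 0
    exact this.eventually hev
  obtain ⟨ε, hε, hball⟩ := Metric.eventually_nhds_iff.1 (hev.and hev')
  obtain ⟨g1, g2⟩ := hball (y := ε / 2) (by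
    rw [Real.dist_eq, sub_zero, abs_of_pos (by linarith)]; linarith)
  have m1 := hm _ g1
  have m2 := hm _ g2
  have s1 : ∀ t : ℝ, ∑ i, w i * (v i + t * d i) = ∑ i, w i * v i + t * ∑ i, w i * d i := by
    intro t
    rw [Finset.mul_sum, ← Finset.sum_add_distrib]
    exact Finset.sum_congr rfl fun i _ => by ring
  simp only [s1] at m1 m2
  have q1 : (fun i => v i + ε / 2 * d i) ∈ Q := by
    refine ⟨g1, ?_⟩
    change ∑ i, w i * (v i + ε / 2 * d i) ≤ _
    rw [s1]
    linarith
  have q2 : (fun i => v i + -(ε / 2) * d i) ∈ Q := by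
    refine ⟨g2, ?_⟩
    change ∑ i, w i * (v i + -(ε / 2) * d i) ≤ _
    rw [s1]
    linarith
  have heq := hext _ q1 _ q2 ⟨1 / 2, 1 / 2, by norm_num, by norm_num, by norm_num, by
    funext i
    simp only [Pi.add_apply, Pi.smul_apply, smul_eq_mul]
    ring⟩
  apply hd0
  funext i
  have := congrFun heq i
  have h5 : ε / 2 * d i = 0 := by linarith
  rcases mul_eq_zero.1 h5 with h | h
  · linarith
  · exact h

lemma mm_half_cases (t : ℝ) (h0 : 0 ≤ t) (h1 : t ≤ 1)
    (h : t ∈ AddSubgroup.zmultiples (1 / 2 : ℝ)) : t = 0 ∨ t = 1 / 2 ∨ t = 1 := by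
  obtain ⟨n, hn⟩ := AddSubgroup.mem_zmultiples_iff.1 h
  rw [zsmul_eq_mul] at hn
  have a1 : (0 : ℝ) ≤ n := by linarith
  have a2 : (n : ℝ) ≤ 2 := by linarith
  have b1 : 0 ≤ n := by exact_mod_cast a1
  have b2 : n ≤ 2 := by exact_mod_cast a2
  rw [← hn]
  interval_cases n
  · left; norm_num
  · right; left; norm_num
  · right; right; norm_num

/-- One single client: choose the cheapest facility of its support. -/
lemma mm_single {F D : Type*} [Fintype F] [Fintype D] [Nonempty D] [Subsingleton D]
    (cf : F → D → ℝ) (hcf : ∀ i j, 0 ≤ cf i j)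
    (f : F → ℝ) (hf : ∀ i, 0 ≤ f i) (dm : D → ℝ) (hdm : ∀ j, 0 ≤ dm j)
    (M : Matroid F)
    (x : F → D → ℝ) (y : F → ℝ)
    (hx : ∀ i j, 0 ≤ x i j) (hxy : ∀ i j, x i j ≤ y i)
    (hrank : ∀ S : Finset F, ∑ i ∈ S, y i ≤ (matroidRank M S : ℝ))
    (hx1 : ∀ j, ∑ i, x i j = 1) :
    ∃ (xh : F → D → ℝ) (yh : F → ℝ),
      (∀ i j, xh i j ∈ ({0, 1/2, 1} : Set ℝ)) ∧
      (∀ i, yh i ∈ ({0, 1/2, 1} : Set ℝ)) ∧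
      (∀ j, ∑ i, xh i j = 1) ∧
      (∀ i j, xh i j ≤ yh i) ∧
      (∀ S : Finset F, ∑ i ∈ S, yh i ≤ (matroidRank M S : ℝ)) ∧
      (∑ i, f i * yh i) + ∑ j, dm j * ∑ i, cf i j * xh i j ≤
        3 * ((∑ i, f i * y i) + ∑ j, dm j * ∑ i, cf i j * x i j) := by
  obtain ⟨j⟩ := ‹Nonempty D›
  have hsum : ∀ g : D → ℝ, ∑ k, g k = g j := fun g => Fintype.sum_subsingleton g j
  have hall : ∀ k, k = j := fun k => Subsingleton.elim k j
  have hne : (univ.filter (fun i => 0 < x i j)).Nonempty := by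
    by_contra h
    rw [Finset.not_nonempty_iff_eq_empty, Finset.filter_eq_empty_iff] at h
    have h0 : ∑ i, x i j = 0 := Finset.sum_eq_zero fun i hi =>
      le_antisymm (not_lt.1 (h hi)) (hx i j)
    rw [hx1] at h0
    norm_num at h0
  obtain ⟨i0, hi0, hmin⟩ := Finset.exists_min_image _ (fun i => f i + dm j * cf i j) hne
  simp only [mem_filter, mem_univ, true_and] at hi0 hmin
  have hlow : f i0 + dm j * cf i0 j ≤ ∑ i, (f i + dm j * cf i j) * x i j := by
    calc f i0 + dm j * cf i0 j = ∑ i, (f i0 + dm j * cf i0 j) * x i j := by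
          rw [← Finset.mul_sum, hx1, mul_one]
      _ ≤ _ := by
          apply Finset.sum_le_sum
          intro i _
          rcases (hx i j).lt_or_eq with h | h
          · exact mul_le_mul_of_nonneg_right (hmin i h) h.le
          · rw [← h]; simp
  have hlow2 : ∑ i, (f i + dm j * cf i j) * x i j ≤
      (∑ i, f i * y i) + dm j * ∑ i, cf i j * x i j := by
    rw [Finset.mul_sum, ← Finset.sum_add_distrib]
    apply Finset.sum_le_sum
    intro i _
    have := mul_le_mul_of_nonneg_left (hxy i j) (hf i)
    linarith
  have hpos : 0 ≤ f i0 + dm j * cf i0 j := add_nonneg (hf _) (mul_nonneg (hdm _) (hcf _ _))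
  refine ⟨fun i _ => if i = i0 then 1 else 0, fun i => if i = i0 then 1 else 0, ?_, ?_, ?_, ?_, ?_, ?_⟩
  · intro i k
    by_cases h : i = i0 <;> simp [h]
  · intro i
    by_cases h : i = i0 <;> simp [h]
  · intro k; simp
  · intro i k; exact le_refl _
  · intro S
    rw [Finset.sum_ite_eq']
    split_ifs with h
    · have h1 : 0 < ∑ i ∈ S, y i := by
        have : y i0 ≤ ∑ i ∈ S, y i :=
          Finset.single_le_sum (fun i _ => (hx i j).trans (hxy i j)) h
        linarith [hxy i0 j]
      have h2 : (0 : ℝ) < matroidRank M S := h1.trans_le (hrank S)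
      have h3 : 0 < matroidRank M S := by exact_mod_cast h2
      exact_mod_cast h3
    · positivity
  · rw [hsum, hsum]
    simp only [mul_ite, mul_one, mul_zero, Finset.sum_ite_eq', mem_univ, if_true]
    linarith

/-- The rounding for clients at positive mutual distance. -/
lemma mm_strict {F D : Type*} [Fintype F] [Fintype D]
    (cf : F → D → ℝ) (cd : D → D → ℝ) (hcf : ∀ i j, 0 ≤ cf i j)
    (htri1 : ∀ i j k, cd j k ≤ cf i j + cf i k)
    (htri2 : ∀ i j k, cf i j ≤ cf i k + cd j k)
    (f : F → ℝ) (hf : ∀ i, 0 ≤ f i) (dm : D → ℝ) (hdm : ∀ j, 0 ≤ dm j)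
    (M : Matroid F)
    (x : F → D → ℝ) (y : F → ℝ)
    (hx : ∀ i j, 0 ≤ x i j) (hy : ∀ i, 0 ≤ y i) (hxy : ∀ i j, x i j ≤ y i)
    (hrank : ∀ S : Finset F, ∑ i ∈ S, y i ≤ (matroidRank M S : ℝ))
    (hx1 : ∀ j, ∑ i, x i j = 1)
    (C : D → ℝ) (hC : ∀ j, C j = ∑ i, cf i j * x i j)
    (hpos : ∀ j k, j ≠ k → 0 < cd j k)
    (hsep1 : ∀ j k, j ≠ k → 4 * C j ≤ cd j k)
    (hsep2 : ∀ j k, j ≠ k → 4 * C k ≤ cd j k) :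
    ∃ (xh : F → D → ℝ) (yh : F → ℝ),
      (∀ i j, xh i j ∈ ({0, 1/2, 1} : Set ℝ)) ∧
      (∀ i, yh i ∈ ({0, 1/2, 1} : Set ℝ)) ∧
      (∀ j, ∑ i, xh i j = 1) ∧
      (∀ i j, xh i j ≤ yh i) ∧
      (∀ S : Finset F, ∑ i ∈ S, yh i ≤ (matroidRank M S : ℝ)) ∧
      (∑ i, f i * yh i) + ∑ j, dm j * ∑ i, cf i j * xh i j ≤
        3 * ((∑ i, f i * y i) + ∑ j, dm j * ∑ i, cf i j * x i j) := by
  rcases isEmpty_or_nonempty D with hD | hD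
  · refine ⟨fun i j => (hD.false j).elim, fun _ => 0, fun i j => (hD.false j).elim, by simp,
      fun j => (hD.false j).elim, fun i j => (hD.false j).elim, by simp, ?_⟩
    have h0 : 0 ≤ ∑ i, f i * y i := Finset.sum_nonneg fun i _ => mul_nonneg (hf i) (hy i)
    simpa using h0
  rcases subsingleton_or_nontrivial D with hD1 | hD1
  · exact mm_single cf hcf f hf dm hdm M x y hx hxy hrank hx1
  have hCnn : ∀ j, 0 ≤ C j := fun j => by
    rw [hC]; exact Finset.sum_nonneg fun i _ => mul_nonneg (hcf _ _) (hx _ _)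
  -- nearest client
  have hnear : ∀ i, ∃ j, ∀ k, cf i j ≤ cf i k := fun i => Finite.exists_min (cf i)
  choose near hnear using hnear
  have hfar : ∀ i j, near i ≠ j → 2 * C j ≤ cf i j ∧ 0 < cf i j := by
    intro i j hij
    have h1 := htri1 i (near i) j
    have h2 := hnear i j
    have h3 := hsep2 _ _ hij
    have h4 := hpos _ _ hij
    constructor <;> linarith
  let A : D → Finset F := fun j => univ.filter (fun i => near i = j ∧ cf i j ≤ 2 * C j)
  have hA : ∀ i j, i ∈ A j ↔ near i = j ∧ cf i j ≤ 2 * C j := fun i j => by simp [A]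
  have hmark : ∀ j, 1 / 2 ≤ ∑ i ∈ A j, x i j := by
    intro j
    have hsplit : ∑ i ∈ A j, x i j + ∑ i ∈ (A j)ᶜ, x i j = 1 := by
      rw [Finset.sum_add_sum_compl, hx1]
    have hle : ∑ i ∈ (A j)ᶜ, cf i j * x i j ≤ C j := by
      rw [hC]
      exact Finset.sum_le_sum_of_subset_of_nonneg (Finset.subset_univ _)
        (fun i _ _ => mul_nonneg (hcf _ _) (hx _ _))
    have hout : ∀ i ∈ (A j)ᶜ, 2 * C j ≤ cf i j ∧ 0 < cf i j := by
      intro i hi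
      rw [Finset.mem_compl, hA] at hi
      by_cases hn : near i = j
      · have : 2 * C j < cf i j := by
          by_contra h
          exact hi ⟨hn, not_lt.1 h⟩
        exact ⟨this.le, by linarith [hCnn j]⟩
      · exact hfar i j hn
    rcases (hCnn j).lt_or_eq with hc | hc
    · have h1 : 2 * C j * ∑ i ∈ (A j)ᶜ, x i j ≤ C j := by
        refine le_trans ?_ hle
        rw [Finset.mul_sum]
        exact Finset.sum_le_sum fun i hi => mul_le_mul_of_nonneg_right (hout i hi).1 (hx _ _)
      have h2 : ∑ i ∈ (A j)ᶜ, x i j ≤ 1 / 2 := by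
        by_contra h
        push Not at h
        have := mul_lt_mul_of_pos_left h hc
        linarith
      linarith
    · have h1 : ∑ i ∈ (A j)ᶜ, x i j = 0 := by
        apply Finset.sum_eq_zero
        intro i hi
        have h2 : cf i j * x i j ≤ ∑ i ∈ (A j)ᶜ, cf i j * x i j :=
          Finset.single_le_sum (f := fun i => cf i j * x i j)
            (fun i _ => mul_nonneg (hcf _ _) (hx _ _)) hi
        have h3 : cf i j * x i j = 0 :=
          le_antisymm (by linarith) (mul_nonneg (hcf _ _) (hx _ _))
        rcases mul_eq_zero.1 h3 with h | h
        · linarith [(hout i hi).2]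
        · exact h
      linarith
  -- the nearest facility belonging to another client
  have hgam : ∀ j, ∃ i, near i ≠ j ∧ ∀ i', near i' ≠ j → cf i j ≤ cf i' j := by
    intro j
    have hne : (univ.filter (fun i => near i ≠ j)).Nonempty := by
      obtain ⟨k, hk⟩ := exists_ne j
      have h1 : (A k).Nonempty := by
        by_contra h
        rw [Finset.not_nonempty_iff_eq_empty] at h
        have := hmark k
        rw [h] at this
        norm_num at this
      obtain ⟨i, hi⟩ := h1
      rw [hA] at hi
      exact ⟨i, by simp [hi.1, hk]⟩
    obtain ⟨i, hi, hmin⟩ := Finset.exists_min_image _ (fun i => cf i j) hne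
    simp only [mem_filter, mem_univ, true_and] at hi hmin
    exact ⟨i, hi, hmin⟩
  choose η hη hηmin using hgam
  let γ : D → ℝ := fun j => cf (η j) j
  have hγ : ∀ j, 2 * C j ≤ γ j := fun j => (hfar _ _ (hη j)).1
  have hγ0 : ∀ j, 0 ≤ γ j := fun j => hcf _ _
  let G : D → Finset F := fun j => univ.filter (fun i => near i = j ∧ cf i j ≤ γ j)
  have hG : ∀ i j, i ∈ G j ↔ near i = j ∧ cf i j ≤ γ j := fun i j => by simp [G]
  have hAG : ∀ j, A j ⊆ G j := by
    intro j i hi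
    rw [hA] at hi
    rw [hG]
    exact ⟨hi.1, hi.2.trans (hγ j)⟩
  have hnG : ∀ i j, i ∉ G j → γ j ≤ cf i j := by
    intro i j hi
    rw [hG] at hi
    by_cases hn : near i = j
    · by_contra h
      exact hi ⟨hn, (not_le.1 h).le⟩
    · exact hηmin j i hn
  -- the starting point
  let y' : F → ℝ := fun i => if i ∈ G (near i) then x i (near i) else y i
  have hy'y : ∀ i, y' i ≤ y i := by
    intro i
    simp only [y']
    split_ifs
    · exact hxy _ _
    · exact le_refl _
  have hy'G : ∀ i j, i ∈ G j → y' i = x i j := by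
    intro i j hi
    have h1 := ((hG i j).1 hi).1
    simp only [y', h1]
    rw [if_pos hi]
  have hy0 : ∀ i, 0 ≤ y i := fun i =>
    let ⟨j⟩ := hD
    (hx i j).trans (hxy i j)
  have hGx : ∀ j, ∑ i ∈ G j, x i j ≤ 1 := fun j => by
    rw [← hx1 j]
    exact Finset.sum_le_sum_of_subset_of_nonneg (Finset.subset_univ _) (fun i _ _ => hx _ _)
  have hfeas : MMFeas (matroidRank M) A G y' := by
    refine ⟨fun i => ?_, fun S => ?_, fun j => ?_, fun j => ?_⟩
    · simp only [y']
      split_ifs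
      · exact hx _ _
      · exact hy0 i
    · exact (Finset.sum_le_sum fun i _ => hy'y i).trans (hrank S)
    · rw [Finset.sum_congr rfl fun i hi => hy'G i j (hAG j hi)]
      exact hmark j
    · rw [Finset.sum_congr rfl fun i hi => hy'G i j hi]
      exact hGx j
  let w : F → ℝ := fun i => f i + ∑ j, if i ∈ G j then dm j * (cf i j - 3 * γ j) else 0
  obtain ⟨v, hv, hvH, hvw⟩ := mm_halfint (matroidRank M) (mm_rank_submod M) (mm_rank_le_card M)
    near A G hAG (fun j i hi => ((hG i j).1 hi).1) w y' hfeas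
  have hw : ∀ u : F → ℝ, ∑ i, w i * u i = ∑ i, f i * u i +
      ∑ j, dm j * (∑ i ∈ G j, cf i j * u i - 3 * γ j * ∑ i ∈ G j, u i) := by
    intro u
    simp only [w, add_mul, Finset.sum_add_distrib]
    congr 1
    simp only [Finset.sum_mul]
    rw [Finset.sum_comm]
    apply Finset.sum_congr rfl
    intro j _
    rw [Finset.mul_sum, ← Finset.sum_sub_distrib, Finset.mul_sum]
    simp only [ite_mul, zero_mul]
    rw [Finset.sum_ite_mem, Finset.univ_inter]
    exact Finset.sum_congr rfl fun i _ => by ring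
  have hv1 : ∀ i, v i ≤ 1 := by
    intro i
    have h1 := hv.rank {i}
    have h2 : (matroidRank M {i} : ℝ) ≤ 1 := by
      exact_mod_cast (by simpa using mm_rank_le_card M {i})
    simp only [Finset.sum_singleton] at h1
    exact h1.trans h2
  have hvc : ∀ i, v i = 0 ∨ v i = 1 / 2 ∨ v i = 1 := fun i =>
    mm_half_cases _ (hv.nonneg i) (hv1 i) (hvH i)
  have hm : ∀ j, ∃ i, i ∈ A j ∧ 1 / 2 ≤ v i := by
    intro j
    by_contra h
    push Not at h
    have h0 : ∑ i ∈ A j, v i = 0 := by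
      apply Finset.sum_eq_zero
      intro i hi
      have := h i hi
      rcases hvc i with h | h | h <;> linarith
    have := hv.lower j
    linarith
  choose m hmA hmv using hm
  let σ : D → D := fun j => near (η j)
  have hσ : ∀ j, σ j ≠ j := hη
  have hmne : ∀ j, m (σ j) ≠ m j := by
    intro j h
    apply hσ j
    have h1 := ((hA _ _).1 (hmA (σ j))).1
    have h2 := ((hA _ _).1 (hmA j)).1
    rw [← h1, h, h2]
  let full : D → Prop := fun j => ∑ i ∈ G j, v i = 1
  let xh : F → D → ℝ := fun i j =>
    if full j then (if i ∈ G j then v i else 0)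
    else (if i = m j then 1 / 2 else 0) + (if i = m (σ j) then 1 / 2 else 0)
  have hxfull : ∀ j, full j → ∀ g : F → ℝ, ∑ i, g i * xh i j = ∑ i ∈ G j, g i * v i := by
    intro j hj g
    simp only [xh, hj, if_true, mul_ite, mul_zero]
    rw [← Finset.sum_filter]
    congr 1
    simp
  have hxnot : ∀ j, ¬ full j → ∀ g : F → ℝ,
      ∑ i, g i * xh i j = 1 / 2 * g (m j) + 1 / 2 * g (m (σ j)) := by
    intro j hj g
    simp only [xh, hj, if_false, mul_add, Finset.sum_add_distrib, mul_ite, mul_zero,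
      Finset.sum_ite_eq', mem_univ, if_true]
    ring
  have hcost : ∀ j, ∑ i, cf i j * xh i j ≤
      ∑ i ∈ G j, cf i j * v i + 3 * γ j * (1 - ∑ i ∈ G j, v i) := by
    intro j
    by_cases hj : full j
    · rw [hxfull j hj]
      have hj' : ∑ i ∈ G j, v i = 1 := hj
      rw [hj']
      linarith
    · rw [hxnot j hj (fun i => cf i j)]
      have hs0 : 1 / 2 ≤ ∑ i ∈ G j, v i := (hv.lower j).trans
        (Finset.sum_le_sum_of_subset_of_nonneg (hAG j) fun i _ _ => hv.nonneg i)
      have hs : ∑ i ∈ G j, v i = 1 / 2 := by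
        rcases mm_half_cases (∑ i ∈ G j, v i) (by linarith) (hv.upper j)
          (AddSubgroup.sum_mem _ fun i _ => hvH i) with h | h | h
        · linarith
        · exact h
        · exact absurd h hj
      have h1 : cf (m j) j * v (m j) ≤ ∑ i ∈ G j, cf i j * v i :=
        Finset.single_le_sum (f := fun i => cf i j * v i)
          (fun i _ => mul_nonneg (hcf _ _) (hv.nonneg _)) (hAG j (hmA j))
      have h2 : cf (m j) j * (1 / 2) ≤ cf (m j) j * v (m j) :=
        mul_le_mul_of_nonneg_left (hmv j) (hcf _ _)
      have h3 := htri2 (m (σ j)) j (σ j)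
      have h4 := ((hA _ _).1 (hmA (σ j))).2
      have h5 := hsep2 j (σ j) (hσ j).symm
      have h6 := htri1 (η j) j (σ j)
      have h7 : cf (η j) (σ j) ≤ cf (η j) j := hnear (η j) j
      have h8 : γ j = cf (η j) j := rfl
      rw [hs]
      linarith
  refine ⟨xh, v, ?_, ?_, ?_, ?_, hv.rank, ?_⟩
  · intro i j
    simp only [Set.mem_insert_iff, Set.mem_singleton_iff, xh]
    split_ifs with h1 h2 h3 h4 h5
    · exact hvc i
    · left; rfl
    · right; right; norm_num
    · right; left; norm_num
    · right; left; norm_num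
    · left; norm_num
  · intro i
    exact hvc i
  · intro j
    by_cases hj : full j
    · have := hxfull j hj (fun _ => 1)
      simp only [one_mul] at this
      rw [this]; exact hj
    · have := hxnot j hj (fun _ => 1)
      simp only [one_mul] at this
      rw [this]; norm_num
  · intro i j
    simp only [xh]
    split_ifs with h1 h2 h3 h4 h5
    · exact le_refl _
    · exact hv.nonneg i
    · exact absurd (h4.symm.trans h3) (hmne j)
    · rw [h3]; linarith [hmv j]
    · rw [h5]; linarith [hmv (σ j)]
    · linarith [hv.nonneg i]
  · have hlp : ∀ j, ∑ i ∈ G j, cf i j * y' i + 3 * γ j * (1 - ∑ i ∈ G j, y' i) ≤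
        3 * ∑ i, cf i j * x i j := by
      intro j
      rw [Finset.sum_congr rfl fun i hi => by rw [hy'G i j hi],
        Finset.sum_congr rfl fun i hi => hy'G i j hi]
      have h1 : ∑ i ∈ G j, x i j + ∑ i ∈ (G j)ᶜ, x i j = 1 := by
        rw [Finset.sum_add_sum_compl, hx1]
      have h2 := Finset.sum_add_sum_compl (G j) (fun i => cf i j * x i j)
      have h3 : γ j * ∑ i ∈ (G j)ᶜ, x i j ≤ ∑ i ∈ (G j)ᶜ, cf i j * x i j := by
        rw [Finset.mul_sum]
        exact Finset.sum_le_sum fun i hi => mul_le_mul_of_nonneg_right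
          (hnG i j (Finset.mem_compl.1 hi)) (hx _ _)
      have h4 : 0 ≤ ∑ i ∈ G j, cf i j * x i j :=
        Finset.sum_nonneg fun i _ => mul_nonneg (hcf _ _) (hx _ _)
      have h5 : 1 - ∑ i ∈ G j, x i j = ∑ i ∈ (G j)ᶜ, x i j := by linarith
      rw [h5, ← h2]
      linarith
    have hT : ∀ u : F → ℝ, ∑ i, w i * u i + ∑ j, dm j * (3 * γ j) = ∑ i, f i * u i +
        ∑ j, dm j * (∑ i ∈ G j, cf i j * u i + 3 * γ j * (1 - ∑ i ∈ G j, u i)) := by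
      intro u
      rw [hw, add_assoc, ← Finset.sum_add_distrib]
      congr 1
      exact Finset.sum_congr rfl fun j _ => by ring
    have t1 : ∑ j, dm j * ∑ i, cf i j * xh i j ≤
        ∑ j, dm j * (∑ i ∈ G j, cf i j * v i + 3 * γ j * (1 - ∑ i ∈ G j, v i)) :=
      Finset.sum_le_sum fun j _ => mul_le_mul_of_nonneg_left (hcost j) (hdm j)
    have t2 : ∑ j, dm j * (∑ i ∈ G j, cf i j * y' i + 3 * γ j * (1 - ∑ i ∈ G j, y' i)) ≤
        3 * ∑ j, dm j * ∑ i, cf i j * x i j := by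
      rw [Finset.mul_sum]
      refine Finset.sum_le_sum fun j _ => ?_
      have := mul_le_mul_of_nonneg_left (hlp j) (hdm j)
      linarith
    have t3 : ∑ i, f i * y' i ≤ ∑ i, f i * y i :=
      Finset.sum_le_sum fun i _ => mul_le_mul_of_nonneg_left (hy'y i) (hf i)
    have t4 : 0 ≤ ∑ i, f i * y i := Finset.sum_nonneg fun i _ => mul_nonneg (hf i) (hy0 i)
    have t5 := hT v
    have t6 := hT y'
    linarith

/-- Given a fractional matroid-median solution on separated clients, there is a
half-integral fractional solution of cost at most 3 times larger. -/
theorem matroid_median_half_integral_solution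
    {F D : Type*} [Fintype F] [Fintype D]
    (c : F ⊕ D → F ⊕ D → ℝ)
    (hc_nonneg : ∀ u v, 0 ≤ c u v)
    (hc_symm : ∀ u v, c u v = c v u)
    (hc_tri : ∀ u v w, c u w ≤ c u v + c v w)
    (f : F → ℝ) (hf : ∀ i, 0 ≤ f i)
    (d' : D → ℝ) (hd' : ∀ j, 0 ≤ d' j)
    (M : Matroid F) (hME : M.E = Set.univ)
    (x : F → D → ℝ) (y : F → ℝ)
    (hx : ∀ i j, 0 ≤ x i j) (hy : ∀ i, 0 ≤ y i)
    (hxy : ∀ i j, x i j ≤ y i)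
    (hrank : ∀ S : Finset F, ∑ i ∈ S, y i ≤ (matroidRank M S : ℝ))
    (hx1 : ∀ j, ∑ i, x i j = 1)
    (Cbar : D → ℝ)
    (hCbar : ∀ j, Cbar j = ∑ i, c (Sum.inl i) (Sum.inr j) * x i j)
    (hsep : ∀ j k : D, j ≠ k →
      4 * max (Cbar j) (Cbar k) ≤ c (Sum.inr j) (Sum.inr k)) :
    ∃ (xh : F → D → ℝ) (yh : F → ℝ),
      (∀ i j, xh i j ∈ ({0, 1/2, 1} : Set ℝ)) ∧
      (∀ i, yh i ∈ ({0, 1/2, 1} : Set ℝ)) ∧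
      (∀ j, ∑ i, xh i j = 1) ∧
      (∀ i j, xh i j ≤ yh i) ∧
      (∀ S : Finset F, ∑ i ∈ S, yh i ≤ (matroidRank M S : ℝ)) ∧
      (∑ i, f i * yh i) + ∑ j, ∑ i, d' j * c (Sum.inl i) (Sum.inr j) * xh i j ≤
        3 * ((∑ i, f i * y i) + ∑ j, ∑ i, d' j * c (Sum.inl i) (Sum.inr j) * x i j) := by
  let st : Setoid D :=
    { r := fun j k => j = k ∨ c (Sum.inr j) (Sum.inr k) = 0
      iseqv :=
        { refl := fun j => Or.inl rfl
          symm := by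
            rintro j k (h | h)
            · exact Or.inl h.symm
            · right; rw [hc_symm]; exact h
          trans := by
            rintro j k l (h | h) (h' | h')
            · exact Or.inl (h.trans h')
            · subst h; exact Or.inr h'
            · subst h'; exact Or.inr h
            · right
              apply le_antisymm _ (hc_nonneg _ _)
              have := hc_tri (Sum.inr j) (Sum.inr k) (Sum.inr l)
              linarith } }
  let Q := Quotient st
  let cls : D → Q := fun j => Quotient.mk st j
  have hrep : ∀ j : D, (cls j).out = j ∨ c (Sum.inr (cls j).out) (Sum.inr j) = 0 := fun j =>
    Quotient.mk_out (s := st) j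
  have hne : ∀ p q : Q, p ≠ q → p.out ≠ q.out ∧ 0 < c (Sum.inr p.out) (Sum.inr q.out) := by
    intro p q hpq
    have h1 : ¬ (p.out = q.out ∨ c (Sum.inr p.out) (Sum.inr q.out) = 0) := by
      intro h
      exact hpq ((Quotient.out_equiv_out (s := st)).1 h)
    push Not at h1
    exact ⟨h1.1, lt_of_le_of_ne (hc_nonneg _ _) (Ne.symm h1.2)⟩
  have hC0 : ∀ j, 0 ≤ Cbar j := fun j => by
    rw [hCbar]; exact Finset.sum_nonneg fun i _ => mul_nonneg (hc_nonneg _ _) (hx _ _)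
  have hCrep : ∀ j, Cbar (cls j).out = Cbar j := by
    intro j
    by_cases h : (cls j).out = j
    · rw [h]
    · have h0 := (hrep j).resolve_left h
      have h1 := hsep _ _ h
      rw [h0] at h1
      have h2 := le_max_left (Cbar (cls j).out) (Cbar j)
      have h3 := le_max_right (Cbar (cls j).out) (Cbar j)
      linarith [hC0 j, hC0 (cls j).out]
  have hcrep : ∀ i j, c (Sum.inl i) (Sum.inr j) = c (Sum.inl i) (Sum.inr (cls j).out) := by
    intro i j
    rcases hrep j with h | h
    · rw [h]
    · have h1 := hc_tri (Sum.inl i) (Sum.inr (cls j).out) (Sum.inr j)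
      have h2 := hc_tri (Sum.inl i) (Sum.inr j) (Sum.inr (cls j).out)
      rw [hc_symm (Sum.inr j)] at h2
      linarith
  let dm : Q → ℝ := fun q => ∑ j ∈ univ.filter (fun j => cls j = q), d' j
  have hdm : ∀ g : Q → ℝ, ∑ q, dm q * g q = ∑ j, d' j * g (cls j) := by
    intro g
    rw [← Finset.sum_fiberwise univ cls]
    apply Finset.sum_congr rfl
    intro q _
    simp only [dm, Finset.sum_mul]
    apply Finset.sum_congr rfl
    intro j hj
    rw [(Finset.mem_filter.1 hj).2]
  obtain ⟨xh, yh, h1, h2, h3, h4, h5, h6⟩ := mm_strict (D := Q)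
    (fun i q => c (Sum.inl i) (Sum.inr q.out)) (fun p q => c (Sum.inr p.out) (Sum.inr q.out))
    (fun i q => hc_nonneg _ _)
    (fun i p q => by
      have := hc_tri (Sum.inr p.out) (Sum.inl i) (Sum.inr q.out)
      rw [hc_symm (Sum.inr p.out) (Sum.inl i)] at this
      exact this)
    (fun i p q => by
      have := hc_tri (Sum.inl i) (Sum.inr q.out) (Sum.inr p.out)
      rw [hc_symm (Sum.inr q.out)] at this
      exact this)
    f hf dm (fun q => Finset.sum_nonneg fun j _ => hd' j) M
    (fun i q => x i q.out) y (fun i q => hx _ _) hy (fun i q => hxy _ _) hrank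
    (fun q => hx1 _) (fun q => Cbar q.out) (fun q => hCbar _)
    (fun p q hpq => (hne p q hpq).2)
    (fun p q hpq => by
      have := hsep _ _ (hne p q hpq).1
      have h2 := le_max_left (Cbar p.out) (Cbar q.out)
      linarith)
    (fun p q hpq => by
      have := hsep _ _ (hne p q hpq).1
      have h2 := le_max_right (Cbar p.out) (Cbar q.out)
      linarith)
  refine ⟨fun i j => xh i (cls j), yh, fun i j => h1 _ _, h2, fun j => h3 _, fun i j => h4 _ _,
    h5, ?_⟩
  rw [hdm, hdm] at h6
  have e1 : ∑ j, ∑ i, d' j * c (Sum.inl i) (Sum.inr j) * xh i (cls j) =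
      ∑ j, d' j * ∑ i, c (Sum.inl i) (Sum.inr (cls j).out) * xh i (cls j) := by
    apply Finset.sum_congr rfl
    intro j _
    rw [Finset.mul_sum]
    apply Finset.sum_congr rfl
    intro i _
    rw [← hcrep, mul_assoc]
  have e2 : ∑ j, ∑ i, d' j * c (Sum.inl i) (Sum.inr j) * x i j =
      ∑ j, d' j * ∑ i, c (Sum.inl i) (Sum.inr (cls j).out) * x i (cls j).out := by
    apply Finset.sum_congr rfl
    intro j _
    rw [← hCbar, hCrep, hCbar, Finset.mul_sum]
    exact Finset.sum_congr rfl fun i _ => mul_assoc _ _ _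
  rw [e1, e2]
  exact h6
end

section
/- For every matroid median instance and every half-integral fractional solution (x̂, ŷ) — a fractional solution all of whose entries x̂_{ij}, ŷ_i lie in {0, 1/2, 1}, with ∑_i x̂_{ij} = 1 for every client j — there exists an integral solution whose cost is at most 2 times the cost of (x̂, ŷ). -/
open scoped Classical
open Finset

lemma two_mul_card_le {U C : Type*} [Fintype U] (p : U → Option C)
    (hp : ∀ u a, p u = some a → ∃ u', u' ≠ u ∧ p u' = some a) :
    2 * ((univ.image p).erase none).card ≤ (univ.filter (fun u => p u ≠ none)).card := by
    have h1 : (univ.filter (fun u => p u ≠ none)).card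
        = ∑ a ∈ (univ.image p).erase none, ((univ.filter (fun u => p u ≠ none)).filter (fun u => p u = a)).card := by
      apply Finset.card_eq_sum_card_fiberwise
      intro u hu
      simp at hu ⊢
      exact hu
    rw [h1, mul_comm, ← smul_eq_mul]
    apply Finset.card_nsmul_le_sum
    intro a ha
    simp only [mem_erase, mem_image, mem_univ, true_and] at ha
    obtain ⟨ha, u, rfl⟩ := ha
    obtain ⟨a, ha'⟩ := Option.ne_none_iff_exists'.1 ha
    obtain ⟨u', hne, hu'⟩ := hp u a ha'
    have : 1 < ((univ.filter (fun u => p u ≠ none)).filter (fun u' => p u' = p u)).card := by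
      rw [Finset.one_lt_card]
      exact ⟨u, by simp [ha], u', by simp [hu', ha'], hne.symm⟩
    omega

lemma exists_dir {U A B : Type*} [Fintype U] [Nonempty U]
    (p : U → Option A) (q : U → Option B)
    (hp : ∀ u a, p u = some a → ∃ u', u' ≠ u ∧ p u' = some a)
    (hq : ∀ u a, q u = some a → ∃ u', u' ≠ u ∧ q u' = some a) :
    ∃ v : U → ℝ, v ≠ 0 ∧ (∀ a, ∑ u with p u = some a, v u = 0) ∧
      (∀ b, ∑ u with q u = some b, v u = 0) := by
  set A' := (univ.image p).erase none with hA'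
  set B' := (univ.image q).erase none with hB'
  have hA : 2 * A'.card ≤ _ := two_mul_card_le p hp
  have hB : 2 * B'.card ≤ _ := two_mul_card_le q hq
  have cA : (univ.filter (fun u => p u ≠ none)).card ≤ Fintype.card U := Finset.card_le_univ _
  have cB : (univ.filter (fun u => q u ≠ none)).card ≤ Fintype.card U := Finset.card_le_univ _
  let L : (U → ℝ) →ₗ[ℝ] ((A' → ℝ) × (B' → ℝ)) :=
    { toFun := fun v => (fun a => ∑ u with p u = a.1, v u, fun b => ∑ u with q u = b.1, v u)
      map_add' := by intro v w; ext <;> simp [Finset.sum_add_distrib]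
      map_smul' := by intro v w; ext <;> simp [Finset.mul_sum] }
  have hfin : Module.finrank ℝ ((A' → ℝ) × (B' → ℝ)) = A'.card + B'.card := by
    simp
  have hfU : Module.finrank ℝ (U → ℝ) = Fintype.card U := by simp
  have hni : ¬ Function.Injective L := by
    intro hinj
    have hle := LinearMap.finrank_le_finrank_of_injective hinj
    rw [hfin, hfU] at hle
    have e1 : (univ.filter (fun u => p u ≠ none)).card = Fintype.card U := by omega
    have e2 : (univ.filter (fun u => q u ≠ none)).card = Fintype.card U := by omega
    have e1' : ∀ u, p u ≠ none := by
      have := (Finset.card_eq_iff_eq_univ _).1 e1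
      intro u; have h := Finset.mem_univ u; rw [← this] at h; simpa using h
    have e2' : ∀ u, q u ≠ none := by
      have := (Finset.card_eq_iff_eq_univ _).1 e2
      intro u; have h := Finset.mem_univ u; rw [← this] at h; simpa using h
    have hsurj := (LinearMap.injective_iff_surjective_of_finrank_eq_finrank
      (f := L) (by rw [hfin, hfU]; omega)).1 hinj
    obtain ⟨u0⟩ := ‹Nonempty U›
    obtain ⟨v, hv⟩ := hsurj (fun _ => 1, fun _ => 0)
    have s1 : ∑ a ∈ A', ∑ u with p u = a, v u = ∑ u, v u :=
      Finset.sum_fiberwise_of_maps_to (fun u _ => by simp [hA', e1']) _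
    have s2 : ∑ a ∈ B', ∑ u with q u = a, v u = ∑ u, v u :=
      Finset.sum_fiberwise_of_maps_to (fun u _ => by simp [hB', e2']) _
    have t1 : ∀ a ∈ A', ∑ u with p u = a, v u = 1 := fun a ha =>
      congrFun (congrArg Prod.fst hv) ⟨a, ha⟩
    have t2 : ∀ a ∈ B', ∑ u with q u = a, v u = 0 := fun a ha =>
      congrFun (congrArg Prod.snd hv) ⟨a, ha⟩
    rw [Finset.sum_congr rfl t1] at s1
    rw [Finset.sum_congr rfl t2] at s2
    simp at s1 s2
    rw [← s2] at s1
    have : A' = ∅ := by simpa using s1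
    have h : p u0 ∈ A' := by simp [hA', e1']
    simp [this] at h
  rw [← LinearMap.ker_eq_bot, Submodule.eq_bot_iff] at hni
  push Not at hni
  obtain ⟨v, hv, hv0⟩ := hni
  have hv' : L v = 0 := hv
  refine ⟨v, hv0, fun a => ?_, fun b => ?_⟩
  · by_cases h : some a ∈ A'
    · exact congrFun (congrArg Prod.fst hv') ⟨_, h⟩
    · apply Finset.sum_eq_zero
      intro u hu
      exact absurd (by simp at hu; rw [← hu]; simp [hA']; simp [hu]) h
  · by_cases h : some b ∈ B'
    · exact congrFun (congrArg Prod.snd hv') ⟨_, h⟩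
    · apply Finset.sum_eq_zero
      intro u hu
      exact absurd (by simp at hu; rw [← hu]; simp [hB']; simp [hu]) h

lemma exists_dir' {E A B : Type*} [Fintype E] (U : Finset E) (hU : U.Nonempty)
    (p : E → Option A) (q : E → Option B)
    (hp : ∀ u ∈ U, ∀ a, p u = some a → ∃ u' ∈ U, u' ≠ u ∧ p u' = some a)
    (hq : ∀ u ∈ U, ∀ a, q u = some a → ∃ u' ∈ U, u' ≠ u ∧ q u' = some a) :
    ∃ v : E → ℝ, v ≠ 0 ∧ (∀ u, u ∉ U → v u = 0) ∧ (∀ a, ∑ u with p u = some a, v u = 0) ∧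
      (∀ b, ∑ u with q u = some b, v u = 0) := by
  have : Nonempty U := hU.to_subtype
  obtain ⟨v, hv, h1, h2⟩ := exists_dir (fun u : U => p u.1) (fun u : U => q u.1)
    (fun u a h => by
      obtain ⟨u', h1, h2, h3⟩ := hp u.1 u.2 a h
      exact ⟨⟨u', h1⟩, fun h => h2 (congrArg Subtype.val h), h3⟩)
    (fun u a h => by
      obtain ⟨u', h1, h2, h3⟩ := hq u.1 u.2 a h
      exact ⟨⟨u', h1⟩, fun h => h2 (congrArg Subtype.val h), h3⟩)
  have key : ∀ P : E → Prop, ∑ u with P u, (if h : u ∈ U then v ⟨u, h⟩ else 0)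
      = ∑ u : U with P u.1, v u := by
    intro P
    rw [Finset.sum_filter, Finset.sum_filter]
    rw [← Finset.sum_subset (Finset.subset_univ U)]
    · rw [← Finset.sum_coe_sort U]
      apply Finset.sum_congr rfl
      intro u _
      simp
    · intro u _ hu
      simp [hu]
  refine ⟨fun u => if h : u ∈ U then v ⟨u, h⟩ else 0, ?_, ?_, ?_, ?_⟩
  · intro h
    apply hv
    ext u
    have := congrFun h u.1
    simpa using this
  · intro u hu; simp [hu]
  · intro a; convert (key (fun u => p u = some a)).trans (Eq.trans (by congr) (h1 a))
  · intro a; convert (key (fun u => q u = some a)).trans (Eq.trans (by congr) (h2 a))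

/-- the polytope -/
def polyP {E D : Type*} (r : Finset E → ℕ) (K : Finset D) (S : D → Finset E) : Set (E → ℝ) :=
  {z | (∀ e, 0 ≤ z e) ∧ (∀ T : Finset E, ∑ e ∈ T, z e ≤ r T) ∧ ∀ k ∈ K, ∑ e ∈ S k, z e = 1}

/-- an element whose whole block has integral weight is not the only fractional one -/
lemma other_frac {E : Type*} (z : E → ℝ) (e : E) (he : e ∈ ({e | z e ≠ 0 ∧ z e ≠ 1} : Set E))
    (h0 : 0 ≤ z e) (h1 : z e ≤ 1) (B : Finset E) (heB : e ∈ B) (n : ℤ)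
    (hB : ∑ e ∈ B, z e = n) : ∃ e' ∈ B, e' ≠ e ∧ z e' ≠ 0 ∧ z e' ≠ 1 := by
  by_contra hcon
  push Not at hcon
  have hint : ∃ m : ℤ, ∑ e' ∈ B.erase e, z e' = m := by
    refine ⟨∑ e' ∈ B.erase e, if z e' = 0 then 0 else 1, ?_⟩
    push_cast
    apply Finset.sum_congr rfl
    intro e' he'
    rw [Finset.mem_erase] at he'
    by_cases h : z e' = 0
    · simp [h]
    · simp [h, hcon e' he'.2 he'.1 h]
  obtain ⟨m, hm⟩ := hint
  rw [← Finset.add_sum_erase _ _ heB, hm] at hB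
  have hz : z e = ((n - m : ℤ) : ℝ) := by push_cast; linarith
  obtain ⟨he0, he1⟩ := he
  rw [hz] at h0 h1 he0 he1
  have a0 : 0 ≤ n - m := by exact_mod_cast h0
  have a1 : n - m ≤ 1 := by exact_mod_cast h1
  have a2 : n - m ≠ 0 := by exact_mod_cast he0
  have a3 : n - m ≠ 1 := by exact_mod_cast he1
  omega

lemma exists_perturb {E D : Type*} [Fintype E] (r : Finset E → ℕ)
    (r0 : r ∅ = 0) (r1 : ∀ e, r {e} ≤ 1)
    (rsub : ∀ A B, r (A ∩ B) + r (A ∪ B) ≤ r A + r B)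
    (K : Finset D) (S : D → Finset E)
    (hS : ∀ k ∈ K, ∀ l ∈ K, k ≠ l → Disjoint (S k) (S l))
    (z : E → ℝ) (hz : z ∈ polyP r K S) (hfrac : ∃ e, z e ≠ 0 ∧ z e ≠ 1) :
    ∃ v : E → ℝ, v ≠ 0 ∧ z + v ∈ polyP r K S ∧ z - v ∈ polyP r K S := by
  obtain ⟨z0, zr, zS⟩ := hz
  have z1 : ∀ e, z e ≤ 1 := fun e => by
    have := zr {e}
    rw [Finset.sum_singleton] at this
    exact this.trans (by exact_mod_cast r1 e)
  let tight : Finset E → Prop := fun T => ∑ e ∈ T, z e = r T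
  have tempty : tight ∅ := by simp [tight, r0]
  have tui : ∀ A B, tight A → tight B → tight (A ∩ B) ∧ tight (A ∪ B) := by
    intro A B hA hB
    simp only [tight] at *
    have h1 := zr (A ∩ B)
    have h2 := zr (A ∪ B)
    have h3 : ∑ e ∈ A ∪ B, z e + ∑ e ∈ A ∩ B, z e = _ := Finset.sum_union_inter
    have h4 : ((r (A ∩ B) : ℝ) + r (A ∪ B)) ≤ r A + r B := by exact_mod_cast rsub A B
    constructor <;> linarith
  have hmin : ∀ e, ∃ T : Finset E, (∃ T', tight T' ∧ e ∈ T') →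
      tight T ∧ e ∈ T ∧ ∀ T', tight T' → e ∈ T' → T ⊆ T' := by
    intro e
    by_cases h : ∃ T', tight T' ∧ e ∈ T'
    · obtain ⟨T0, hT0⟩ := h
      obtain ⟨T, hT, hTm⟩ := Finset.exists_min_image
        (univ.filter (fun T => tight T ∧ e ∈ T)) Finset.card ⟨T0, by simpa using hT0⟩
      simp only [mem_filter, mem_univ, true_and] at hT hTm
      refine ⟨T, fun _ => ⟨hT.1, hT.2, fun T' h1 h2 => ?_⟩⟩
      have := hTm (T ∩ T') ⟨(tui _ _ hT.1 h1).1, by simp [hT.2, h2]⟩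
      have := Finset.eq_of_subset_of_card_le Finset.inter_subset_left this
      exact Finset.inter_eq_left.1 this
    · exact ⟨∅, fun h' => absurd h' h⟩
  choose m hm using hmin
  let p : E → Option (Finset E) := fun e => if (∃ T', tight T' ∧ e ∈ T') then some (m e) else none
  let q : E → Option D := fun e => if h : ∃ k ∈ K, e ∈ S k then some h.choose else none
  have hpe : ∀ e a, p e = some a ↔ (∃ T', tight T' ∧ e ∈ T') ∧ m e = a := by
    intro e a
    simp only [p]
    split_ifs with h <;> simp [h]
  have hqe : ∀ e k, q e = some k ↔ k ∈ K ∧ e ∈ S k := by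
    intro e k
    simp only [q]
    split_ifs with h
    · have hc := h.choose_spec
      simp only [Option.some.injEq]
      constructor
      · rintro rfl; exact hc
      · intro hk
        by_contra hne
        exact Finset.disjoint_left.1 (hS _ hc.1 _ hk.1 hne) hc.2 hk.2
    · simp only [reduceCtorEq, false_iff]
      rintro ⟨h1, h2⟩; exact h ⟨k, h1, h2⟩
  have tbiU : ∀ (I : Finset E), (∀ g ∈ I, tight (m g)) → tight (I.biUnion m) := by
    intro I
    induction I using Finset.induction_on with
    | empty => intro _; simpa using tempty
    | insert a s _ ih =>
      intro h
      rw [Finset.biUnion_insert]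
      exact (tui _ _ (h a (by simp)) (ih (fun g hg => h g (by simp [hg])))).2
  obtain ⟨v, hv0, hvU, hvp, hvq⟩ := exists_dir' (univ.filter (fun e => z e ≠ 0 ∧ z e ≠ 1))
    (by obtain ⟨e, he⟩ := hfrac; exact ⟨e, by simpa using he⟩) p q
    (by
      intro e he a hea
      simp only [mem_filter, mem_univ, true_and] at he
      obtain ⟨hte, rfl⟩ := (hpe e a).1 hea
      obtain ⟨mt, mm, mmin⟩ := hm e hte
      have ht : ∀ f ∈ m e, ∃ T', tight T' ∧ f ∈ T' := fun f hf => ⟨_, mt, hf⟩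
      set R := ((m e).filter (fun f => m f ≠ m e)).biUnion m with hR
      have hRt : tight R := tbiU _ (fun g hg => (hm g (ht g (Finset.mem_filter.1 hg).1)).1)
      have hRs : R ⊆ m e := by
        intro f hf
        rw [hR, Finset.mem_biUnion] at hf
        obtain ⟨g, hg, hfg⟩ := hf
        exact (hm g (ht g (Finset.mem_filter.1 hg).1)).2.2 _ mt (Finset.mem_filter.1 hg).1 hfg
      have heR : e ∉ R := by
        intro hf
        rw [hR, Finset.mem_biUnion] at hf
        obtain ⟨g, hg, hfg⟩ := hf
        rw [Finset.mem_filter] at hg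
        have hg' := hm g (ht g hg.1)
        exact hg.2 (Finset.Subset.antisymm (hg'.2.2 _ mt hg.1) (mmin _ hg'.1 hfg))
      obtain ⟨e', he', hne, hf⟩ := other_frac z e he (z0 e) (z1 e) (m e \ R)
        (by simp [mm, heR]) ((r (m e) : ℤ) - r R) (by
          have := Finset.sum_sdiff (f := z) hRs
          simp only [tight] at mt hRt
          push_cast; linarith)
      rw [Finset.mem_sdiff] at he'
      refine ⟨e', by simpa using hf, hne, (hpe _ _).2 ⟨ht _ he'.1, ?_⟩⟩
      by_contra hcon
      apply he'.2
      rw [hR, Finset.mem_biUnion]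
      exact ⟨e', by simp [he'.1, hcon], (hm e' (ht e' he'.1)).2.1⟩)
    (by
      intro e he k hek
      simp only [mem_filter, mem_univ, true_and] at he
      obtain ⟨hk, hek⟩ := (hqe _ _).1 hek
      obtain ⟨e', he', hne, hf⟩ := other_frac z e he (z0 e) (z1 e) (S k) hek 1
        (by rw [zS k hk]; simp)
      exact ⟨e', by simpa using hf, hne, (hqe _ _).2 ⟨hk, he'⟩⟩)
  have hvS : ∀ k ∈ K, ∑ e ∈ S k, v e = 0 := by
    intro k hk
    rw [← hvq k]
    apply Finset.sum_congr _ (fun _ _ => rfl)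
    ext e; simp [hqe, hk]
  have hvT : ∀ T, tight T → ∑ e ∈ T, v e = 0 := by
    intro T hT
    rw [← Finset.sum_fiberwise_of_maps_to (s := T) (t := T.image m) (g := m)
      (fun e he => Finset.mem_image_of_mem _ he)]
    apply Finset.sum_eq_zero
    intro a ha
    obtain ⟨e, he, rfl⟩ := Finset.mem_image.1 ha
    rw [← hvp (m e)]
    apply Finset.sum_congr _ (fun _ _ => rfl)
    ext e'
    simp only [mem_filter, mem_univ, true_and, hpe]
    constructor
    · rintro ⟨h1, h2⟩; exact ⟨⟨T, hT, h1⟩, h2⟩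
    · rintro ⟨h1, h2⟩
      refine ⟨?_, h2⟩
      have := (hm e' h1).2.1
      rw [h2] at this
      exact (hm e ⟨T, hT, he⟩).2.2 T hT he this
  have hev : ∀ᶠ t : ℝ in nhds 0, (∀ e, 0 ≤ z e + t * v e) ∧
      (∀ T : Finset E, ∑ e ∈ T, z e + t * ∑ e ∈ T, v e ≤ r T) := by
    rw [Filter.eventually_and, Filter.eventually_all, Filter.eventually_all]
    constructor
    · intro e
      by_cases h : z e = 0
      · have : v e = 0 := hvU e (by simp [h])
        simp [h, this]
      · have hlt : 0 < z e + 0 * v e := by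
          have := lt_of_le_of_ne (z0 e) (Ne.symm h); simpa using this
        have hc : Continuous (fun t : ℝ => z e + t * v e) := by fun_prop
        filter_upwards [hc.continuousAt.eventually (lt_mem_nhds hlt)] with t ht using ht.le
    · intro T
      by_cases h : tight T
      · rw [hvT T h]; simp [zr T]
      · have hlt : ∑ e ∈ T, z e + 0 * ∑ e ∈ T, v e < r T := by
          have := lt_of_le_of_ne (zr T) h; simpa using this
        have hc : Continuous (fun t : ℝ => ∑ e ∈ T, z e + t * ∑ e ∈ T, v e) := by fun_prop
        filter_upwards [hc.continuousAt.eventually (gt_mem_nhds hlt)] with t ht using ht.le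
  obtain ⟨δ, hδ, hball⟩ := Metric.eventually_nhds_iff.1 hev
  have hmem : ∀ t : ℝ, |t| < δ → z + t • v ∈ polyP r K S := by
    intro t ht
    obtain ⟨h1, h2⟩ := hball (y := t) (by simpa using ht)
    refine ⟨fun e => by simpa using h1 e, fun T => ?_, fun k hk => ?_⟩
    · have := h2 T
      simpa [Finset.sum_add_distrib, Finset.mul_sum] using this
    · simp [Finset.sum_add_distrib, ← Finset.mul_sum, zS k hk, hvS k hk]
  refine ⟨(δ / 2) • v, ?_, hmem _ ?_, ?_⟩
  · exact smul_ne_zero (by positivity) hv0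
  · rw [abs_of_pos (by positivity)]; linarith
  · have := hmem (-(δ / 2)) (by rw [abs_neg, abs_of_pos (by positivity)]; linarith)
    simpa [sub_eq_add_neg] using this

lemma exists_integral {E D : Type*} [Fintype E] (r : Finset E → ℕ)
    (r0 : r ∅ = 0) (r1 : ∀ e, r {e} ≤ 1)
    (rsub : ∀ A B, r (A ∩ B) + r (A ∪ B) ≤ r A + r B)
    (K : Finset D) (S : D → Finset E)
    (hS : ∀ k ∈ K, ∀ l ∈ K, k ≠ l → Disjoint (S k) (S l))
    (w : E → ℝ) (y : E → ℝ) (hy : y ∈ polyP r K S) :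
    ∃ z ∈ polyP r K S, (∀ e, z e = 0 ∨ z e = 1) ∧ ∑ e, w e * z e ≤ ∑ e, w e * y e := by
  have hclosed : IsClosed (polyP r K S) := by
    have : polyP r K S = (⋂ e, {z : E → ℝ | 0 ≤ z e}) ∩ ((⋂ T : Finset E, {z : E → ℝ | ∑ e ∈ T, z e ≤ r T})
        ∩ ⋂ k ∈ K, {z : E → ℝ | ∑ e ∈ S k, z e = 1}) := by
      ext z; simp [polyP]
    rw [this]
    refine IsClosed.inter (isClosed_iInter fun e => ?_) (IsClosed.inter
      (isClosed_iInter fun T => ?_) (isClosed_biInter fun k _ => ?_))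
    · exact isClosed_le continuous_const (by fun_prop)
    · exact isClosed_le (by fun_prop) continuous_const
    · exact isClosed_eq (by fun_prop) continuous_const
  have hcomp : IsCompact (polyP r K S) := by
    apply IsCompact.of_isClosed_subset (isCompact_Icc (a := (0 : E → ℝ)) (b := 1)) hclosed
    intro z hz
    refine ⟨fun e => hz.1 e, fun e => ?_⟩
    have := hz.2.1 {e}
    rw [Finset.sum_singleton] at this
    exact this.trans (by simpa using r1 e)
  have hwc : Continuous (fun z : E → ℝ => ∑ e, w e * z e) := by fun_prop
  obtain ⟨z₁, hz₁, hzmin⟩ := hcomp.exists_isMinOn ⟨y, hy⟩ hwc.continuousOn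
  have hzmin' : ∀ z ∈ polyP r K S, ∑ e, w e * z₁ e ≤ ∑ e, w e * z e := fun z hz => hzmin hz
  have hK : IsCompact (polyP r K S ∩ {z | ∑ e, w e * z e = ∑ e, w e * z₁ e}) :=
    hcomp.inter_right (isClosed_eq hwc continuous_const)
  obtain ⟨z, hz⟩ := hK.extremePoints_nonempty ⟨z₁, hz₁, rfl⟩
  have hzK := hz.1
  refine ⟨z, hzK.1, ?_, ?_⟩
  · by_contra hcon
    push Not at hcon
    obtain ⟨v, hv0, hp, hm⟩ := exists_perturb r r0 r1 rsub K S hS z hzK.1 hcon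
    have a1 := hzmin' _ hp
    have a2 := hzmin' _ hm
    have a3 : ∑ e, w e * z e = ∑ e, w e * z₁ e := hzK.2
    have b1 : ∑ e, w e * (z + v) e = ∑ e, w e * z e + ∑ e, w e * v e := by
      simp [mul_add, Finset.sum_add_distrib]
    have b2 : ∑ e, w e * (z - v) e = ∑ e, w e * z e - ∑ e, w e * v e := by
      simp [mul_sub, Finset.sum_sub_distrib]
    have := hz.2 (x₁ := z + v) ⟨hp, by show _ = _; linarith⟩ (x₂ := z - v)
      ⟨hm, by show _ = _; linarith⟩
      ⟨1 / 2, 1 / 2, by norm_num, by norm_num, by norm_num, by ext e; simp; ring⟩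
    apply hv0
    simpa using this
  · have a3 : ∑ e, w e * z e = ∑ e, w e * z₁ e := hzK.2
    rw [a3]; exact hzmin' y hy

lemma matroidRank_eq {α : Type*} (M : Matroid α) (S : Finset α) :
    (matroidRank M S : ℕ∞) = M.eRk (S : Set α) := by
  apply le_antisymm
  · obtain ⟨I, hI, hIe⟩ := Finset.exists_mem_eq_sup
      (S.powerset.filter (fun I : Finset α => M.Indep (I : Set α)))
      ⟨∅, by simp⟩ Finset.card
    simp only [mem_filter, mem_powerset] at hI
    rw [matroidRank, hIe, ← Set.encard_coe_eq_coe_finsetCard]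
    exact hI.2.encard_le_eRk_of_subset (by exact_mod_cast hI.1)
  · rw [Matroid.eRk_le_iff]
    intro I hIS hI
    lift I to Finset α using S.finite_toSet.subset hIS
    rw [Set.encard_coe_eq_coe_finsetCard]
    exact_mod_cast Finset.le_sup (f := Finset.card)
      (s := S.powerset.filter (fun I : Finset α => M.Indep (I : Set α))) (b := I)
      (by simp only [mem_filter, mem_powerset]; exact ⟨by exact_mod_cast hIS, hI⟩)

lemma exists_centers {F D : Type*} [Fintype D] (S : D → Finset F) (hne : ∀ j, (S j).Nonempty)
    (C : D → ℝ) : ∃ K : Finset D, (∀ k ∈ K, ∀ l ∈ K, k ≠ l → Disjoint (S k) (S l)) ∧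
      ∀ j, ∃ k ∈ K, ∃ i, i ∈ S j ∧ i ∈ S k ∧ C k ≤ C j := by
  have : ∀ A : Finset D, ∃ K ⊆ A, (∀ k ∈ K, ∀ l ∈ K, k ≠ l → Disjoint (S k) (S l)) ∧
      ∀ j ∈ A, ∃ k ∈ K, ∃ i, i ∈ S j ∧ i ∈ S k ∧ C k ≤ C j := by
    intro A
    induction A using Finset.induction_on_max_value C with
    | empty => exact ⟨∅, by simp⟩
    | insert a s ha hmax ih =>
      obtain ⟨K, hKs, hdis, hcov⟩ := ih
      by_cases h : ∃ k ∈ K, ∃ i, i ∈ S a ∧ i ∈ S k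
      · refine ⟨K, hKs.trans (Finset.subset_insert _ _), hdis, fun j hj => ?_⟩
        rcases Finset.mem_insert.1 hj with rfl | hj
        · obtain ⟨k, hk, i, h1, h2⟩ := h
          exact ⟨k, hk, i, h1, h2, hmax k (hKs hk)⟩
        · exact hcov j hj
      · have hd : ∀ k ∈ K, Disjoint (S a) (S k) := fun k hk =>
          Finset.disjoint_left.2 fun i h1 h2 => h ⟨k, hk, i, h1, h2⟩
        refine ⟨insert a K, Finset.insert_subset_insert _ hKs, ?_, fun j hj => ?_⟩
        · intro k hk l hl hkl
          rcases Finset.mem_insert.1 hk with hk' | hk'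
          · rcases Finset.mem_insert.1 hl with hl' | hl'
            · exact absurd (hk'.trans hl'.symm) hkl
            · rw [hk']; exact hd l hl'
          · rcases Finset.mem_insert.1 hl with hl' | hl'
            · rw [hl']; exact (hd k hk').symm
            · exact hdis k hk' l hl' hkl
        · rcases Finset.mem_insert.1 hj with rfl | hj
          · obtain ⟨i, hi⟩ := hne j
            exact ⟨j, by simp, i, hi, hi, le_rfl⟩
          · obtain ⟨k, hk, hr⟩ := hcov j hj
            exact ⟨k, by simp [hk], hr⟩
  obtain ⟨K, _, h1, h2⟩ := this univ
  exact ⟨K, h1, fun j => h2 j (by simp)⟩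

/-- Any half-integral fractional matroid-median solution can be rounded to an
integral solution while losing a factor of at most 2 in the cost. -/
theorem matroid_median_round_half_integral
    {F D : Type*} [Fintype F] [Fintype D]
    (c : F ⊕ D → F ⊕ D → ℝ)
    (hc_nonneg : ∀ u v, 0 ≤ c u v)
    (hc_symm : ∀ u v, c u v = c v u)
    (hc_tri : ∀ u v w, c u w ≤ c u v + c v w)
    (f : F → ℝ) (hf : ∀ i, 0 ≤ f i)
    (d : D → ℝ) (hd : ∀ j, 0 ≤ d j)
    (M : Matroid F) (hME : M.E = Set.univ)
    (x : F → D → ℝ) (y : F → ℝ)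
    (hx : ∀ i j, 0 ≤ x i j) (hy : ∀ i, 0 ≤ y i)
    (hx1 : ∀ j, 1 ≤ ∑ i, x i j)
    (hxy : ∀ i j, x i j ≤ y i)
    (hrank : ∀ S : Finset F, ∑ i ∈ S, y i ≤ (matroidRank M S : ℝ))
    (hhalf_x : ∀ i j, x i j ∈ ({0, 1/2, 1} : Set ℝ))
    (hhalf_y : ∀ i, y i ∈ ({0, 1/2, 1} : Set ℝ))
    (hxsum : ∀ j, ∑ i, x i j = 1) :
    ∃ (Fs : Finset F) (σ : D → F),
      M.Indep ↑Fs ∧ (∀ j, σ j ∈ Fs) ∧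
      (∑ i ∈ Fs, f i) + ∑ j, d j * c (Sum.inl (σ j)) (Sum.inr j) ≤
        2 * ((∑ i, f i * y i) + ∑ j, ∑ i, d j * c (Sum.inl i) (Sum.inr j) * x i j) := by
  have hx2 : ∀ i j, 0 < x i j → 1 / 2 ≤ x i j := by
    intro i j h
    rcases hhalf_x i j with h' | h' | h'
    · exact absurd h' h.ne'
    · exact h'.ge
    · rw [h']; norm_num
  let S : D → Finset F := fun j => univ.filter (fun i => 0 < x i j)
  have memS : ∀ i j, i ∈ S j ↔ 0 < x i j := by intro i j; simp [S]
  have sumS : ∀ j, ∑ i ∈ S j, x i j = 1 := by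
    intro j
    rw [← hxsum j]
    apply Finset.sum_subset (Finset.subset_univ _)
    intro i _ hi
    rw [memS] at hi
    exact le_antisymm (not_lt.1 hi) (hx i j)
  have hne : ∀ j, (S j).Nonempty := by
    intro j
    by_contra h
    rw [Finset.not_nonempty_iff_eq_empty] at h
    have := sumS j
    rw [h] at this; simp at this
  let g : F → D → ℝ := fun i j => c (Sum.inl i) (Sum.inr j)
  have g0 : ∀ i j, 0 ≤ g i j := fun i j => hc_nonneg _ _
  have gtri : ∀ i i' j k, g i' j ≤ g i j + (g i k + g i' k) := by
    intro i i' j k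
    have h1 := hc_tri (Sum.inl i') (Sum.inr k) (Sum.inr j)
    have h2 := hc_tri (Sum.inr k) (Sum.inl i) (Sum.inr j)
    have h3 := hc_symm (Sum.inr k) (Sum.inl i)
    simp only [g]; linarith
  let C : D → ℝ := fun j => ∑ i, g i j * x i j
  have C0 : ∀ j, 0 ≤ C j := fun j => Finset.sum_nonneg fun i _ => mul_nonneg (g0 i j) (hx i j)
  have C1 : ∀ i j, g i j * x i j ≤ C j := fun i j =>
    Finset.single_le_sum (f := fun i => g i j * x i j)
      (fun i _ => mul_nonneg (g0 i j) (hx i j)) (Finset.mem_univ i)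
  have C2 : ∀ i i' j, i ≠ i' → 0 < x i j → 0 < x i' j → g i j + g i' j ≤ 2 * C j := by
    intro i i' j hii hi hi'
    have h1 : ∑ e ∈ {i, i'}, g e j * x e j ≤ C j :=
      Finset.sum_le_sum_of_subset_of_nonneg (Finset.subset_univ _)
        (fun i _ _ => mul_nonneg (g0 i j) (hx i j))
    rw [Finset.sum_pair hii] at h1
    have h2 := mul_le_mul_of_nonneg_left (hx2 i j hi) (g0 i j)
    have h3 := mul_le_mul_of_nonneg_left (hx2 i' j hi') (g0 i' j)
    linarith
  obtain ⟨K, hdis, hcov⟩ := exists_centers S hne C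
  -- the starting fractional point
  have hz : ∀ i, ∃ t : ℝ, t ≤ y i ∧ 0 ≤ t ∧ (∀ k ∈ K, i ∈ S k → t = x i k) ∧
      (∀ j, 0 < x i j → 1 / 2 ≤ t) := by
    intro i
    by_cases h : ∃ k ∈ K, i ∈ S k
    · obtain ⟨k, hk, hik⟩ := h
      refine ⟨x i k, hxy i k, hx i k, fun l hl hil => ?_, fun j _ => hx2 i k ((memS _ _).1 hik)⟩
      by_cases hkl : k = l
      · rw [hkl]
      · exact absurd hil (Finset.disjoint_left.1 (hdis k hk l hl hkl) hik)
    · exact ⟨y i, le_rfl, hy i, fun k hk hik => absurd ⟨k, hk, hik⟩ h,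
        fun j hj => (hx2 i j hj).trans (hxy i j)⟩
  choose z zy z0 zK zh using hz
  have hzP : z ∈ polyP (matroidRank M) K S := by
    refine ⟨z0, fun T => (Finset.sum_le_sum fun i _ => zy i).trans (hrank T), fun k hk => ?_⟩
    rw [← sumS k]
    exact Finset.sum_congr rfl fun i hi => zK i k hk hi
  have hT : ∀ j, ∃ (α : F → ℝ) (β : ℝ), ∑ i, α i * z i + β ≤ 2 * C j ∧
      ∀ z' ∈ polyP (matroidRank M) K S, (∀ e, z' e = 0 ∨ z' e = 1) →
        ∃ s, z' s = 1 ∧ g s j ≤ ∑ i, α i * z' i + β := by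
    intro j
    obtain ⟨k, hk, i, hij, hik, hCk⟩ := hcov j
    rw [memS] at hij
    have hzi := zh i j hij
    have hfar : ∀ z' ∈ polyP (matroidRank M) K S, (∀ e, z' e = 0 ∨ z' e = 1) → z' i = 0 →
        ∃ s, z' s = 1 ∧ g s j ≤ g i j + 2 * C k := by
      intro z' hz' hint hi0
      have hex : ∃ s ∈ S k, z' s ≠ 0 := by
        by_contra hcon
        push Not at hcon
        have := hz'.2.2 k hk
        rw [Finset.sum_eq_zero hcon] at this
        norm_num at this
      obtain ⟨s, hs, hs0⟩ := hex
      have his : i ≠ s := by rintro rfl; exact hs0 hi0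
      have h1 := C2 i s k his ((memS _ _).1 hik) ((memS _ _).1 hs)
      have h2 := gtri i s j k
      exact ⟨s, (hint s).resolve_left hs0, by linarith⟩
    by_cases hle : g i j ≤ C j
    · refine ⟨Pi.single i (-(2 * C k)), g i j + 2 * C k, ?_, ?_⟩
      · simp only [Pi.single_apply, ite_mul, zero_mul, Finset.sum_ite_eq', Finset.mem_univ, if_true]
        have := mul_le_mul_of_nonneg_left hzi (C0 k)
        linarith
      · intro z' hz' hint
        simp only [Pi.single_apply, ite_mul, zero_mul, Finset.sum_ite_eq', Finset.mem_univ, if_true]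
        rcases hint i with h | h
        · obtain ⟨s, hs, hs'⟩ := hfar z' hz' hint h
          exact ⟨s, hs, by rw [h]; linarith⟩
        · exact ⟨i, h, by rw [h]; linarith⟩
    · push Not at hle
      have hex : ∃ o, o ≠ i ∧ 0 < x o j := by
        by_contra hcon
        push Not at hcon
        have h1 := hxsum j
        rw [Finset.sum_eq_single i (fun o _ ho => le_antisymm (hcon o ho) (hx o j))
          (fun h => absurd (Finset.mem_univ i) h)] at h1
        have := C1 i j
        rw [h1] at this
        linarith
      obtain ⟨o, hoi, hoj⟩ := hex
      have hco := C2 i o j hoi.symm hij hoj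
      have hzo := zh o j hoj
      refine ⟨Pi.single i (-(2 * C k)) + Pi.single o (-(g i j - g o j)), g i j + 2 * C k, ?_, ?_⟩
      · simp only [Pi.add_apply, add_mul, Finset.sum_add_distrib, Pi.single_apply, ite_mul,
          zero_mul, Finset.sum_ite_eq', Finset.mem_univ, if_true]
        have h1 := mul_le_mul_of_nonneg_left hzi (C0 k)
        have h2 := mul_le_mul_of_nonneg_left hzo (show 0 ≤ g i j - g o j by linarith)
        linarith
      · intro z' hz' hint
        simp only [Pi.add_apply, add_mul, Finset.sum_add_distrib, Pi.single_apply, ite_mul,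
          zero_mul, Finset.sum_ite_eq', Finset.mem_univ, if_true]
        have hCk0 := C0 k
        rcases hint o with ho | ho
        · rcases hint i with h | h
          · obtain ⟨s, hs, hs'⟩ := hfar z' hz' hint h
            exact ⟨s, hs, by rw [h, ho]; linarith⟩
          · exact ⟨i, h, by rw [h, ho]; linarith⟩
        · refine ⟨o, ho, ?_⟩
          rcases hint i with h | h <;> rw [h, ho] <;> linarith
  choose α β hαβ hαβ' using hT
  have r0 : matroidRank M ∅ = 0 := by
    have := matroidRank_eq M ∅
    simpa using this
  have r1 : ∀ e, matroidRank M {e} ≤ 1 := by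
    intro e
    have h1 := matroidRank_eq M {e}
    have h2 := M.eRk_singleton_le e
    rw [Finset.coe_singleton] at h1
    rw [← h1] at h2
    exact_mod_cast h2
  have rsub : ∀ A B, matroidRank M (A ∩ B) + matroidRank M (A ∪ B)
      ≤ matroidRank M A + matroidRank M B := by
    intro A B
    have h := M.eRk_inter_add_eRk_union_le (A : Set F) (B : Set F)
    rw [← Finset.coe_inter, ← Finset.coe_union, ← matroidRank_eq, ← matroidRank_eq,
      ← matroidRank_eq, ← matroidRank_eq] at h
    exact_mod_cast h
  obtain ⟨z', hz'P, hint, hcost⟩ := exists_integral (matroidRank M) r0 r1 rsub K S hdis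
    (fun i => f i + ∑ j, d j * α j i) z hzP
  have expand : ∀ t : F → ℝ, ∑ i, (f i + ∑ j, d j * α j i) * t i
      = ∑ i, f i * t i + ∑ j, d j * ∑ i, α j i * t i := by
    intro t
    simp only [add_mul, Finset.sum_add_distrib, Finset.sum_mul, Finset.mul_sum]
    congr 1
    rw [Finset.sum_comm]
    simp only [mul_assoc]
  rw [expand, expand] at hcost
  choose σ hσ hσ' using fun j => hαβ' j z' hz'P hint
  refine ⟨univ.filter (fun i => z' i = 1), σ, ?_, fun j => by simp [hσ], ?_⟩
  · set I : Finset F := univ.filter (fun i => z' i = 1) with hI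
    have h1 := hz'P.2.1 I
    have h2 : ∑ e ∈ I, z' e = I.card := by
      rw [Finset.sum_congr rfl (g := fun _ => (1 : ℝ)) (fun e he => by simpa [hI] using he)]
      simp
    rw [h2] at h1
    have h3 : I.card ≤ matroidRank M I := by exact_mod_cast h1
    rw [Matroid.indep_iff_eRk_eq_encard_of_finite I.finite_toSet]
    apply le_antisymm (Matroid.eRk_le_encard _ _)
    rw [← matroidRank_eq, Set.encard_coe_eq_coe_finsetCard]
    exact_mod_cast h3
  · have hfz : ∑ i ∈ univ.filter (fun i => z' i = 1), f i = ∑ i, f i * z' i := by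
      rw [Finset.sum_filter]
      apply Finset.sum_congr rfl
      intro i _
      rcases hint i with h | h <;> simp [h]
    have e1 : ∑ j, d j * g (σ j) j ≤ ∑ j, d j * (∑ i, α j i * z' i + β j) :=
      Finset.sum_le_sum fun j _ => mul_le_mul_of_nonneg_left (hσ' j) (hd j)
    have e2 : ∑ j, d j * (∑ i, α j i * z i + β j) ≤ ∑ j, d j * (2 * C j) :=
      Finset.sum_le_sum fun j _ => mul_le_mul_of_nonneg_left (hαβ j) (hd j)
    simp only [mul_add, Finset.sum_add_distrib] at e1 e2
    have e3 : ∑ i, f i * z i ≤ ∑ i, f i * y i :=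
      Finset.sum_le_sum fun i _ => mul_le_mul_of_nonneg_left (zy i) (hf i)
    have e4 : 0 ≤ ∑ i, f i * y i := Finset.sum_nonneg fun i _ => mul_nonneg (hf i) (hy i)
    have e5 : ∑ j, d j * (2 * C j) = 2 * ∑ j, ∑ i, d j * c (Sum.inl i) (Sum.inr j) * x i j := by
      simp only [C, g, Finset.mul_sum]
      apply Finset.sum_congr rfl; intro j _
      apply Finset.sum_congr rfl; intro i _
      ring
    rw [hfz]
    simp only [g] at e1
    linarith
end
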